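/- arXiv:1803.09384 — 5 statements merged into one kernel-verified Lean document; each statement's English description precedes it below -/
import Mathlib

section
/- Let H be a Zariski-closed subgroup of GL_n(ℝ). Then there exist m ≥ 1, a group homomorphism ρ : GL_n(ℝ) → GL_m(ℝ) each of whose m² matrix-entry functions is a polynomial in the matrix entries of g and det(g)⁻¹, and a one-dimensional linear subspace l ⊆ ℝ^m, such that H = {g ∈ GL_n(ℝ) : ρ(g)(l) = l}. -/
open Matrix MvPolynomial

/-- The point of ℝ^{n²+1} recording the matrix entries of `g` together with `det(g)⁻¹`. -/
noncomputable def entriesDet {n : ℕ} (g : GL (Fin n) ℝ) : (Fin n × Fin n) ⊕ Unit → ℝ :=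
  Sum.elim (fun p => (g : Matrix (Fin n) (Fin n) ℝ) p.1 p.2)
    (fun _ => ((g : Matrix (Fin n) (Fin n) ℝ).det)⁻¹)

/-- A subgroup of GL_n(ℝ) is Zariski-closed if it is cut out by a set of real polynomials
in the matrix entries and the inverse of the determinant. -/
def IsZariskiClosedSubgroup {n : ℕ} (H : Subgroup (GL (Fin n) ℝ)) : Prop :=
  ∃ T : Set (MvPolynomial ((Fin n × Fin n) ⊕ Unit) ℝ),
    ∀ g : GL (Fin n) ℝ, g ∈ H ↔ ∀ P ∈ T, eval (entriesDet g) P = 0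

section FunctionSpaces

variable {G X Y κ : Type*}

/-- Precomposition with a map, as a homomorphism of algebras of real functions. -/
def precompAlgHom (φ : X → Y) : (Y → ℝ) →ₐ[ℝ] (X → ℝ) :=
  AlgHom.pi fun x => Pi.evalAlgHom ℝ _ (φ x)

@[simp]
lemma precompAlgHom_apply (φ : X → Y) (f : Y → ℝ) (x : X) : precompAlgHom φ f x = f (φ x) := rfl

/-- Local finiteness: if translation acts on the functions `c k` through matrix coefficients in
the algebra `A`, then every polynomial in the `c k` lies in a finite-dimensional
translation-invariant space, all of whose orbit functions lie in `A`. -/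
lemma exists_fg_invariant_of_mem_adjoin [Fintype κ] (τ : G → X → X) (A : Subalgebra ℝ (G → ℝ))
    (c : κ → X → ℝ) (a : κ → κ → G → ℝ) (ha : ∀ k k', a k k' ∈ A)
    (hc : ∀ k g x, c k (τ g x) = ∑ k', a k k' g * c k' x)
    {f : X → ℝ} (hf : f ∈ Algebra.adjoin ℝ (Set.range c)) :
    ∃ U : Submodule ℝ (X → ℝ), U.FG ∧ f ∈ U ∧
      (∀ g, U.map (precompAlgHom (τ g)).toLinearMap ≤ U) ∧
      ∀ x, U.map (precompAlgHom fun g => τ g x).toLinearMap ≤ A.toSubmodule := by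
  induction hf using Algebra.adjoin_induction with
  | mem f hf =>
    refine ⟨Submodule.span ℝ (Set.range c), Submodule.fg_span (Set.finite_range c),
      Submodule.subset_span hf, fun g => ?_, fun x => ?_⟩
    · rw [Submodule.map_span_le]
      rintro _ ⟨k, rfl⟩
      have : (precompAlgHom (τ g)).toLinearMap (c k) = ∑ k', a k k' g • c k' := by
        ext x
        simp [hc]
      rw [this]
      exact Submodule.sum_mem _ fun k' _ =>
        Submodule.smul_mem _ _ (Submodule.subset_span ⟨k', rfl⟩)
    · rw [Submodule.map_span_le]
      rintro _ ⟨k, rfl⟩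
      have : (precompAlgHom fun g => τ g x).toLinearMap (c k) = ∑ k', c k' x • a k k' := by
        ext g
        simp [hc, mul_comm]
      rw [this]
      exact Submodule.sum_mem _ fun k' _ => Submodule.smul_mem _ _ (ha k k')
  | algebraMap r =>
    refine ⟨1, Submodule.one_eq_span (R := ℝ) (A := X → ℝ) ▸ Submodule.fg_span_singleton 1, Submodule.algebraMap_mem r, fun g => ?_, fun x => ?_⟩
    · rw [Submodule.map_one]
    · rw [Submodule.map_one, Submodule.one_le]
      exact A.one_mem
  | add f₁ f₂ _ _ h₁ h₂ =>
    obtain ⟨U₁, fg₁, m₁, i₁, r₁⟩ := h₁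
    obtain ⟨U₂, fg₂, m₂, i₂, r₂⟩ := h₂
    refine ⟨U₁ ⊔ U₂, fg₁.sup fg₂, Submodule.add_mem_sup m₁ m₂, fun g => ?_, fun x => ?_⟩
    · rw [Submodule.map_sup]
      exact sup_le_sup (i₁ g) (i₂ g)
    · rw [Submodule.map_sup]
      exact sup_le (r₁ x) (r₂ x)
  | mul f₁ f₂ _ _ h₁ h₂ =>
    obtain ⟨U₁, fg₁, m₁, i₁, r₁⟩ := h₁
    obtain ⟨U₂, fg₂, m₂, i₂, r₂⟩ := h₂
    refine ⟨U₁ * U₂, fg₁.mul fg₂, Submodule.mul_mem_mul m₁ m₂, fun g => ?_, fun x => ?_⟩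
    · rw [Submodule.map_mul]
      exact mul_le_mul' (i₁ g) (i₂ g)
    · rw [Submodule.map_mul]
      refine Submodule.mul_le.2 fun u hu v hv => A.mul_mem (r₁ x hu) (r₂ x hv)

/-- Local finiteness for simultaneous right translation on a power of `G`, for polynomials in
the coordinates of the factors. -/
lemma exists_fg_invariant_of_mem_adjoin_pi {ι : Type*} [Fintype ι] [Fintype κ] [Mul G]
    (A : Subalgebra ℝ (G → ℝ)) (c : κ → G → ℝ) (a : κ → κ → G → ℝ) (ha : ∀ k k', a k k' ∈ A)
    (hc : ∀ k g x, c k (x * g) = ∑ k', a k k' g * c k' x) {f : (ι → G) → ℝ}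
    (hf : f ∈ Algebra.adjoin ℝ (Set.range fun (k : ι × κ) (x : ι → G) => c k.2 (x k.1))) :
    ∃ U : Submodule ℝ ((ι → G) → ℝ), U.FG ∧ f ∈ U ∧
      (∀ g : G, U.map (precompAlgHom fun x i => x i * g).toLinearMap ≤ U) ∧
      ∀ x : ι → G, U.map (precompAlgHom fun g i => x i * g).toLinearMap ≤ A.toSubmodule := by
  classical
  let τ : G → (ι → G) → ι → G := fun g x i => x i * g
  let c' : ι × κ → (ι → G) → ℝ := fun k x => c k.2 (x k.1)
  let a' : ι × κ → ι × κ → G → ℝ := fun k k' => if k.1 = k'.1 then a k.2 k'.2 else 0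
  have ha' : ∀ k k', a' k k' ∈ A := fun k k' => by
    dsimp only [a']
    split_ifs
    · exact ha _ _
    · exact Subalgebra.zero_mem _
  have hc' : ∀ k g x, c' k (τ g x) = ∑ k', a' k k' g * c' k' x := fun k g x => by
    simp [a', c', τ, hc, Fintype.sum_prod_type_right, ite_apply, ite_mul]
  have hfc : f ∈ Algebra.adjoin ℝ (Set.range c') := hf
  exact exists_fg_invariant_of_mem_adjoin τ A c' a' ha' hc' hfc

/-- Point evaluations span the dual of a finite-dimensional space of functions. -/
lemma span_range_eval_eq_top (U : Submodule ℝ (X → ℝ)) [FiniteDimensional ℝ U] :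
    Submodule.span ℝ (Set.range fun x => (LinearMap.proj x).comp U.subtype) =
      (⊤ : Submodule ℝ (U →ₗ[ℝ] ℝ)) := by
  refine Submodule.span_eq_top_of_ne_zero fun u hu => ?_
  have hu' : (u : X → ℝ) ≠ 0 := by simpa using hu
  obtain ⟨x, hx⟩ := Function.ne_iff.1 hu'
  exact ⟨_, ⟨x, rfl⟩, hx⟩

/-- Linearly independent functions have a nonvanishing generalized Vandermonde determinant. -/
lemma exists_det_ne_zero_of_linearIndependent {d : ℕ} {w : Fin d → X → ℝ}
    (hw : LinearIndependent ℝ w) :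
    ∃ y : Fin d → X, (Matrix.of fun i j => w j (y i)).det ≠ 0 := by
  let s : Set (Fin d → ℝ) := Set.range fun x j => w j x
  have hspan : Submodule.span ℝ s = ⊤ := by
    by_contra hne
    obtain ⟨φ, hφ, hle⟩ := Submodule.exists_le_ker_of_lt_top _ (lt_top_iff_ne_top.2 hne)
    have hsum : ∑ j, φ (Pi.single j 1) • w j = 0 := by
      ext x
      have h0 : φ (fun j => w j x) = 0 := hle (Submodule.subset_span ⟨x, rfl⟩)
      rw [← LinearMap.sum_single_apply (fun _ : Fin d => ℝ) (fun j => w j x), map_sum] at h0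
      rw [Finset.sum_apply, Pi.zero_apply, ← h0]
      refine Finset.sum_congr rfl fun j _ => ?_
      have hj : Pi.single j (w j x) = w j x • (Pi.single j 1 : Fin d → ℝ) := by
        rw [← Pi.single_smul, smul_eq_mul, mul_one]
      rw [hj, map_smul, Pi.smul_apply, smul_eq_mul, smul_eq_mul, mul_comm]
    have h1 := Fintype.linearIndependent_iff.1 hw _ hsum
    exact hφ (LinearMap.pi_ext' fun j => LinearMap.ext_ring (by simpa using h1 j))
  have hex := Submodule.exists_fun_fin_finrank_span_eq ℝ s
  rw [hspan, finrank_top, Module.finrank_fin_fun] at hex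
  obtain ⟨f, hfs, -, hli⟩ := hex
  choose y hy using hfs
  refine ⟨y, ?_⟩
  have hrow : (Matrix.of fun i j => w j (y i)).row = f := by
    ext i j
    exact congrFun (hy i) j
  rw [← isUnit_iff_ne_zero, ← Matrix.isUnit_iff_isUnit_det,
    ← Matrix.linearIndependent_rows_iff_isUnit, hrow]
  exact hli

/-- A finite-dimensional translation-invariant space `U` of functions whose orbit functions lie in
`A` yields a matrix representation with entries in `A`, in which lines of `U` become lines of
coordinate vectors. -/
lemma exists_matrix_representation [Group G] (τ : G → X → X) (τ_one : ∀ x, τ 1 x = x)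
    (τ_mul : ∀ g h x, τ (g * h) x = τ h (τ g x)) (A : Submodule ℝ (G → ℝ))
    (U : Submodule ℝ (X → ℝ)) [FiniteDimensional ℝ U]
    (hU : ∀ g, U.map (precompAlgHom (τ g)).toLinearMap ≤ U)
    (hA : ∀ x, U.map (precompAlgHom fun g => τ g x).toLinearMap ≤ A)
    {f : X → ℝ} (hf : f ∈ U) (hf0 : f ≠ 0) :
    ∃ m : ℕ, 1 ≤ m ∧ ∃ ρ : G →* GL (Fin m) ℝ,
      (∀ i j, (fun g => (ρ g : Matrix (Fin m) (Fin m) ℝ) i j) ∈ A) ∧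
      ∃ l : Submodule ℝ (Fin m → ℝ), Module.finrank ℝ l = 1 ∧
        ∀ g, Submodule.map (Matrix.mulVecLin (ρ g : Matrix (Fin m) (Fin m) ℝ)) l = l ↔
          ∃ r : ℝ, r ≠ 0 ∧ ∀ x, f (τ g x) = r * f x := by
  let π : G →* (U →ₗ[ℝ] U) :=
    { toFun := fun g => (precompAlgHom (τ g)).toLinearMap.restrict
        fun u hu => hU g (Submodule.mem_map_of_mem hu)
      map_one' := by
        ext u x
        simp [τ_one]
      map_mul' := fun g h => by
        ext u x
        simp [τ_mul] }
  have hπ : ∀ g (u : U) x, (π g u : X → ℝ) x = (u : X → ℝ) (τ g x) := fun _ _ _ => rfl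
  let u₀ : U := ⟨f, hf⟩
  have hu₀ : u₀ ≠ 0 := fun h => hf0 (congrArg Subtype.val h)
  let b := Module.finBasis ℝ U
  let ρ : G →* GL (Fin (Module.finrank ℝ U)) ℝ :=
    (((LinearMap.toMatrixAlgEquiv b : (U →ₗ[ℝ] U) →* _)).comp π).toHomUnits
  have hρ : ∀ g, (ρ g : Matrix _ _ ℝ) = LinearMap.toMatrix b b (π g) := fun _ => rfl
  have hcoord : ∀ (φ : U →ₗ[ℝ] ℝ) (u : U), (fun g => φ (π g u)) ∈ A := by
    intro φ u
    have hφ : φ ∈ Submodule.span ℝ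
        (Set.range fun x => (LinearMap.proj x).comp U.subtype) := by
      rw [span_range_eval_eq_top]
      trivial
    induction hφ using Submodule.span_induction with
    | mem φ h =>
      obtain ⟨x, rfl⟩ := h
      exact hA x (Submodule.mem_map_of_mem u.2)
    | zero => exact A.zero_mem
    | add φ ψ _ _ h₁ h₂ => exact A.add_mem h₁ h₂
    | smul r φ _ h => exact A.smul_mem r h
  have hv : b.equivFun u₀ ≠ 0 := by simpa using hu₀
  refine ⟨_, Module.finrank_pos_iff_exists_ne_zero.2 ⟨u₀, hu₀⟩, ρ, fun i j => ?_,
    Submodule.span ℝ {b.equivFun u₀}, finrank_span_singleton hv, fun g => ?_⟩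
  · simpa [hρ, LinearMap.toMatrix_apply] using hcoord (b.coord i) (b j)
  · have himg : Matrix.mulVecLin (ρ g : Matrix _ _ ℝ) (b.equivFun u₀) = b.equivFun (π g u₀) := by
      rw [hρ, Matrix.mulVecLin_apply]
      exact LinearMap.toMatrix_mulVec_repr b b (π g) u₀
    rw [Submodule.map_span, Set.image_singleton, himg, Submodule.span_singleton_eq_span_singleton]
    constructor
    · rintro ⟨z, hz⟩
      refine ⟨(z⁻¹ : ℝˣ), z⁻¹.ne_zero, fun x => ?_⟩
      have h1 : π g u₀ = z⁻¹ • u₀ := by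
        rw [eq_inv_smul_iff]
        apply b.equivFun.injective
        rw [← hz]
        exact map_smul b.equivFun (z : ℝ) _
      exact congrFun (congrArg Subtype.val h1) x
    · rintro ⟨r, hr, h⟩
      refine ⟨(Units.mk0 r hr)⁻¹, ?_⟩
      rw [inv_smul_eq_iff]
      have h1 : π g u₀ = r • u₀ := by
        ext x
        exact h x
      rw [h1]
      exact map_smul b.equivFun r _

end FunctionSpaces

section GeneralLinearGroup

variable {n : ℕ}

/-- The algebra of regular functions on `GL_n(ℝ)`. -/
noncomputable def regularFunctions (n : ℕ) : Subalgebra ℝ (GL (Fin n) ℝ → ℝ) :=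
  Algebra.adjoin ℝ (Set.range fun s g => entriesDet g s)

lemma mem_regularFunctions {f : GL (Fin n) ℝ → ℝ} :
    f ∈ regularFunctions n ↔
      ∃ P : MvPolynomial ((Fin n × Fin n) ⊕ Unit) ℝ, ∀ g, f g = eval (entriesDet g) P := by
  have key : ∀ (P : MvPolynomial ((Fin n × Fin n) ⊕ Unit) ℝ) (g : GL (Fin n) ℝ),
      aeval (fun s (g : GL (Fin n) ℝ) => entriesDet g s) P g = eval (entriesDet g) P := by
    intro P g
    have h : (Pi.evalAlgHom ℝ (fun _ : GL (Fin n) ℝ => ℝ) g).comp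
        (aeval fun s (g : GL (Fin n) ℝ) => entriesDet g s) = aeval (entriesDet g) :=
      MvPolynomial.algHom_ext fun s => by simp
    exact DFunLike.congr_fun h P
  rw [regularFunctions, Algebra.adjoin_range_eq_range_aeval, AlgHom.mem_range]
  constructor
  · rintro ⟨P, rfl⟩
    exact ⟨P, key P⟩
  · rintro ⟨P, hP⟩
    refine ⟨P, ?_⟩
    ext g
    rw [hP]
    exact key P g

lemma entriesDet_mem_regularFunctions (s : (Fin n × Fin n) ⊕ Unit) :
    (fun g => entriesDet g s) ∈ regularFunctions n :=
  Algebra.subset_adjoin ⟨s, rfl⟩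

/-- Right translation acts linearly on the coordinates of `GL_n(ℝ)`, with regular coefficients. -/
lemma exists_entriesDet_mul (n : ℕ) :
    ∃ a : (Fin n × Fin n) ⊕ Unit → (Fin n × Fin n) ⊕ Unit → GL (Fin n) ℝ → ℝ,
      (∀ s s', a s s' ∈ regularFunctions n) ∧
      ∀ s g x, entriesDet (x * g) s = ∑ s', a s s' g * entriesDet x s' := by
  refine ⟨fun s s' => Sum.elim
    (fun p => Sum.elim
      (fun q => if p.1 = q.1 then fun g => entriesDet g (Sum.inl (q.2, p.2)) else 0)
      (fun _ => 0) s')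
    (fun _ => Sum.elim (fun _ => 0) (fun _ g => entriesDet g (Sum.inr ())) s') s, ?_, ?_⟩
  · rintro (⟨i, j⟩ | _) (⟨i', k⟩ | _)
    · dsimp
      split_ifs
      · exact entriesDet_mem_regularFunctions _
      · exact Subalgebra.zero_mem _
    · exact Subalgebra.zero_mem _
    · exact Subalgebra.zero_mem _
    · exact entriesDet_mem_regularFunctions (Sum.inr ())
  · rintro (⟨i, j⟩ | _) g x
    · simp [entriesDet, Fintype.sum_prod_type, Matrix.mul_apply, ite_apply, ite_mul, mul_comm]
    · simp [entriesDet, mul_comm]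

/-- Over the reals, a Zariski-closed subgroup is the zero locus of a single polynomial. -/
lemma IsZariskiClosedSubgroup.exists_polynomial {H : Subgroup (GL (Fin n) ℝ)}
    (hH : IsZariskiClosedSubgroup H) :
    ∃ F : MvPolynomial ((Fin n × Fin n) ⊕ Unit) ℝ, ∀ g, g ∈ H ↔ eval (entriesDet g) F = 0 := by
  obtain ⟨T, hT⟩ := hH
  obtain ⟨S, hST, hS⟩ := (Submodule.fg_span_iff_fg_span_finset_subset T).1
    (IsNoetherian.noetherian (Ideal.span T))
  refine ⟨∑ P ∈ S, P ^ 2, fun g => ?_⟩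
  rw [map_sum, Finset.sum_eq_zero_iff_of_nonneg fun P _ => by rw [map_pow]; positivity, hT]
  simp only [map_pow, pow_eq_zero_iff two_ne_zero]
  refine ⟨fun h P hP => h P (hST hP), fun h P hP => ?_⟩
  have hle : Ideal.span (S : Set (MvPolynomial ((Fin n × Fin n) ⊕ Unit) ℝ)) ≤
      RingHom.ker (eval (entriesDet g)) := Ideal.span_le.2 h
  have hPS : P ∈ Ideal.span (S : Set (MvPolynomial ((Fin n × Fin n) ⊕ Unit) ℝ)) :=
    hS.le (Submodule.subset_span hP)
  exact hle hPS

/-- A Zariski-closed subgroup is the stabilizer of the line spanned by some nonzero regular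
function on a power of `GL_n(ℝ)`. -/
lemma IsZariskiClosedSubgroup.exists_semiinvariant {H : Subgroup (GL (Fin n) ℝ)}
    (hH : IsZariskiClosedSubgroup H) :
    ∃ (d : ℕ) (f : (Fin d → GL (Fin n) ℝ) → ℝ),
      f ∈ Algebra.adjoin ℝ (Set.range fun (k : Fin d × ((Fin n × Fin n) ⊕ Unit))
        (x : Fin d → GL (Fin n) ℝ) => entriesDet (x k.1) k.2) ∧
      f ≠ 0 ∧
      ∀ g, g ∈ H ↔ ∃ r : ℝ, r ≠ 0 ∧ ∀ x, f (fun i => x i * g) = r * f x := by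
  obtain ⟨F, hF⟩ := hH.exists_polynomial
  obtain ⟨a, ha, hmul⟩ := exists_entriesDet_mul n
  obtain ⟨V, hVfg, hFV, hVinv, hVreg⟩ := exists_fg_invariant_of_mem_adjoin
    (fun g x : GL (Fin n) ℝ => x * g) (regularFunctions n) _ a ha hmul
    (mem_regularFunctions.2 ⟨F, fun _ => rfl⟩)
  let W : Submodule ℝ (GL (Fin n) ℝ → ℝ) := V ⊓ ⨅ h ∈ H, LinearMap.ker (LinearMap.proj h)
  have hW : ∀ u, u ∈ W ↔ u ∈ V ∧ ∀ h ∈ H, u h = 0 := by simp [W]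
  have : FiniteDimensional ℝ V := Module.Finite.iff_fg.2 hVfg
  have : FiniteDimensional ℝ W := Submodule.finiteDimensional_of_le inf_le_left
  let b := Module.finBasis ℝ W
  have hbW : ∀ j, (b j : GL (Fin n) ℝ → ℝ) ∈ V ∧ ∀ h ∈ H, (b j : GL (Fin n) ℝ → ℝ) h = 0 :=
    fun j => (hW _).1 (b j).2
  have hexpand : ∀ {u : GL (Fin n) ℝ → ℝ} (hu : u ∈ W) (x : GL (Fin n) ℝ),
      u x = ∑ k, b.repr ⟨u, hu⟩ k * (b k : GL (Fin n) ℝ → ℝ) x := by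
    intro u hu x
    have h := congrArg (fun v : W => (v : GL (Fin n) ℝ → ℝ) x) (b.sum_repr ⟨u, hu⟩)
    simpa [-Module.Basis.sum_repr, Finset.sum_apply] using h.symm
  have hbreg : ∀ j, (b j : GL (Fin n) ℝ → ℝ) ∈ regularFunctions n := fun j => by
    simpa [precompAlgHom] using! hVreg 1 (Submodule.mem_map_of_mem (hbW j).1)
  let M : (Fin (Module.finrank ℝ W) → GL (Fin n) ℝ) →
      Matrix (Fin (Module.finrank ℝ W)) (Fin (Module.finrank ℝ W)) ℝ :=
    fun x => Matrix.of fun i j => (b j : GL (Fin n) ℝ → ℝ) (x i)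
  obtain ⟨y, hy⟩ : ∃ y, (M y).det ≠ 0 := exists_det_ne_zero_of_linearIndependent
    (b.linearIndependent.map' W.subtype (Submodule.ker_subtype W))
  refine ⟨_, fun x => (M x).det, ?_, fun h => hy (congrFun h y), fun g => ⟨fun hg => ?_, ?_⟩⟩
  · have hentry : ∀ i j, (fun x => M x i j) ∈ Algebra.adjoin ℝ (Set.range
        fun (k : Fin (Module.finrank ℝ W) × ((Fin n × Fin n) ⊕ Unit))
        (x : Fin (Module.finrank ℝ W) → GL (Fin n) ℝ) => entriesDet (x k.1) k.2) := by
      intro i j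
      have h := (Subalgebra.mem_map (f := precompAlgHom
        fun x : Fin (Module.finrank ℝ W) → GL (Fin n) ℝ => x i)).2 ⟨_, hbreg j, rfl⟩
      rw [regularFunctions, AlgHom.map_adjoin] at h
      refine Algebra.adjoin_mono ?_ h
      rintro _ ⟨_, ⟨s, rfl⟩, rfl⟩
      exact ⟨(i, s), rfl⟩
    have hdet : (fun x => (M x).det) =
        ∑ σ : Equiv.Perm (Fin (Module.finrank ℝ W)),
          ((Equiv.Perm.sign σ : ℤ) : ℝ) • ∏ i, fun x => M x (σ i) i := by
      ext x
      simp [Matrix.det_apply']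
    rw [hdet]
    exact Subalgebra.sum_mem _ fun σ _ => Subalgebra.smul_mem _
      (Subalgebra.prod_mem _ fun i _ => hentry _ _) _
  · have htr : ∀ j, (precompAlgHom fun x : GL (Fin n) ℝ => x * g) (b j) ∈ W := fun j =>
      (hW _).2 ⟨hVinv g (Submodule.mem_map_of_mem (hbW j).1),
        fun h hh => (hbW j).2 _ (H.mul_mem hh hg)⟩
    let C : Matrix (Fin (Module.finrank ℝ W)) (Fin (Module.finrank ℝ W)) ℝ :=
      Matrix.of fun k j => b.repr ⟨_, htr j⟩ k
    have hMC : ∀ x, M (fun i => x i * g) = M x * C := by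
      intro x
      ext i j
      simpa [M, C, Matrix.mul_apply, mul_comm] using! hexpand (htr j) (x i)
    have hdet : ∀ x, (M fun i => x i * g).det = C.det * (M x).det := fun x => by
      rw [hMC, Matrix.det_mul, mul_comm]
    refine ⟨C.det, fun h0 => hy ?_, hdet⟩
    simpa [h0] using hdet fun i => y i * g⁻¹
  · rintro ⟨r, hr, hrf⟩
    have hvanish : ∀ j, (b j : GL (Fin n) ℝ → ℝ) g = 0 := by
      let B := M fun i => y i * g
      have hB : B.det ≠ 0 := by
        rw [show B.det = r * (M y).det from hrf y]
        exact mul_ne_zero hr hy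
      let z : Fin (Module.finrank ℝ W) → ℝ := fun j => (b j : GL (Fin n) ℝ → ℝ) g
      have hz : Matrix.cramer Bᵀ z = 0 := by
        ext i
        rw [Matrix.cramer_transpose_apply]
        have h1 : B.updateRow i z = M fun k => Function.update y i 1 k * g := by
          ext k j
          by_cases hk : k = i
          · subst hk
            simp [M, z]
          · simp [M, B, Matrix.updateRow_ne hk, Function.update_of_ne hk]
        rw [h1, show (M fun k => Function.update y i 1 k * g).det =
            r * (M (Function.update y i 1)).det from hrf _,
          Matrix.det_eq_zero_of_row_eq_zero i fun j => ?_, mul_zero, Pi.zero_apply]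
        simpa [M] using (hbW j).2 1 H.one_mem
      have h := Matrix.mulVec_cramer Bᵀ z
      rw [hz, Matrix.mulVec_zero, Matrix.det_transpose, eq_comm, smul_eq_zero] at h
      exact congrFun (h.resolve_left hB)
    rw [hF]
    have hFW : (fun x => eval (entriesDet x) F) ∈ W := (hW _).2 ⟨hFV, fun h hh => (hF h).1 hh⟩
    simpa [hvanish] using hexpand hFW g

end GeneralLinearGroup

/-- Chevalley's theorem: a Zariski-closed subgroup `H` of `GL_n(ℝ)` is the stabilizer of a
line `l ⊆ ℝ^m` under a homomorphism `ρ : GL_n(ℝ) → GL_m(ℝ)` whose matrix entries are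
polynomials in the entries and the inverse determinant. -/
theorem chevalley_stabilizer_of_line {n : ℕ} (H : Subgroup (GL (Fin n) ℝ))
    (hH : IsZariskiClosedSubgroup H) :
    ∃ m : ℕ, 1 ≤ m ∧ ∃ ρ : GL (Fin n) ℝ →* GL (Fin m) ℝ,
      (∀ i j : Fin m, ∃ P : MvPolynomial ((Fin n × Fin n) ⊕ Unit) ℝ,
        ∀ g : GL (Fin n) ℝ,
          (ρ g : Matrix (Fin m) (Fin m) ℝ) i j = eval (entriesDet g) P) ∧
      ∃ l : Submodule ℝ (Fin m → ℝ), Module.finrank ℝ l = 1 ∧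
        ∀ g : GL (Fin n) ℝ, g ∈ H ↔
          Submodule.map (Matrix.mulVecLin (ρ g : Matrix (Fin m) (Fin m) ℝ)) l = l := by
  obtain ⟨d, f, hfreg, hf0, hfH⟩ := hH.exists_semiinvariant
  obtain ⟨a, ha, hmul⟩ := exists_entriesDet_mul n
  obtain ⟨U, hUfg, hfU, hUinv, hUreg⟩ :=
    exists_fg_invariant_of_mem_adjoin_pi (regularFunctions n) (fun s g => entriesDet g s)
      a ha hmul hfreg
  have : FiniteDimensional ℝ U := Module.Finite.iff_fg.2 hUfg
  let τ : GL (Fin n) ℝ → (Fin d → GL (Fin n) ℝ) → Fin d → GL (Fin n) ℝ := fun g x i => x i * g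
  have τ_one : ∀ x, τ 1 x = x := fun x => by simp [τ]
  have τ_mul : ∀ g h x, τ (g * h) x = τ h (τ g x) := fun g h x => by simp [τ, mul_assoc]
  obtain ⟨m, hm, ρ, hρ, l, hl, hstab⟩ := exists_matrix_representation τ τ_one τ_mul
    (regularFunctions n).toSubmodule U hUinv hUreg hfU hf0
  exact ⟨m, hm, ρ, fun i j => mem_regularFunctions.1 (hρ i j), l, hl,
    fun g => (hfH g).trans (hstab g).symm⟩
end

section
/- Let G ⊆ GL_n(ℝ) be a Zariski-closed subgroup, let G⁺ denote the connected component of the identity of G in the euclidean topology, and let M ⊆ G⁺ be a compact connected subgroup. Then there exist d ≥ 1 and a regular map p : GL_n(ℝ) → ℝ^d such that: (i) for all g, g' ∈ G⁺ one has p(g) = p(g') if and only if gM = g'M; (ii) the image p(G⁺) is a semialgebraic subset of ℝ^d; (iii) the induced bijection from the quotient G⁺/M (with the quotient topology) onto p(G⁺) (with the euclidean topology) is a homeomorphism. In particular G⁺/M carries a structure of semialgebraic set for which the projection G⁺ → G⁺/M is semialgebraic. -/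
open Matrix MvPolynomial Pointwise

/-- A map GL_n(ℝ) → ℝ^d is regular if each coordinate is a polynomial in the matrix
entries and the inverse determinant. -/
def IsRegularMap {n d : ℕ} (p : GL (Fin n) ℝ → (Fin d → ℝ)) : Prop :=
  ∃ P : Fin d → MvPolynomial ((Fin n × Fin n) ⊕ Unit) ℝ,
    ∀ (g : GL (Fin n) ℝ) (i : Fin d), p g i = eval (entriesDet g) (P i)

/-- Semialgebraic subsets of ℝ^m : finite unions of basic semialgebraic sets. -/
def IsSemialgebraic {m : ℕ} (A : Set (Fin m → ℝ)) : Prop :=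
  ∃ (k : ℕ) (B : Fin k → Set (Fin m → ℝ)),
    (∀ i, ∃ (p : MvPolynomial (Fin m) ℝ) (r : ℕ) (q : Fin r → MvPolynomial (Fin m) ℝ),
      B i = {x | eval x p = 0 ∧ ∀ j, 0 < eval x (q j)}) ∧
    A = ⋃ i, B i

section Colorings

variable {κ : Type*}

/-- If `fx` takes a negative value on a cell where it is increasing, so does `fy` on the
corresponding cell. -/
lemma exists_neg_of_matching {cx cy : ℝ → κ} {fx fy fx' : ℝ → ℝ} {P : Set κ}
    (Tx : ∀ s u t, s ≤ u → u ≤ t → cx s = cx t → cx u = cx s)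
    (Ty : ∀ s u t, s ≤ u → u ≤ t → cy s = cy t → cy u = cy s)
    (hxy : ∀ s t, s ≤ t → ∃ s' t', s' ≤ t' ∧ cy s' = cx s ∧ cy t' = cx t)
    (hyx : ∀ s t, s ≤ t → ∃ s' t', s' ≤ t' ∧ cx s' = cy s ∧ cx t' = cy t)
    (Px : ∀ s t, cx s ∈ P → cx s = cx t → s = t)
    (Py : ∀ s t, cy s ∈ P → cy s = cy t → s = t)
    (Oy : ∀ s, cy s ∉ P → ∀ᶠ t in nhds s, cy t = cy s)
    (hP : ∀ s t, cx s ∈ P → cx s = cy t → SignType.sign (fx s) = SignType.sign (fy t))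
    (dx : ∀ t, HasDerivAt fx (fx' t) t) (hfy : Continuous fy)
    {s₀ t₀ : ℝ} (h₀ : cx s₀ = cy t₀) (hnP : cx s₀ ∉ P)
    (pos : ∀ u, cx u = cx s₀ → 0 < fx' u)
    (hbot : (∀ t ≤ t₀, cy t = cy t₀) → ∃ t ≤ t₀, fy t < 0)
    (hneg : fx s₀ < 0) : ∃ t, cy t = cy t₀ ∧ fy t < 0 := by
  by_contra! H
  set K : Set ℝ := {t | cy t = cy t₀} with hK
  have t₀K : t₀ ∈ K := rfl
  have hbdd : BddBelow K := by
    by_contra hb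
    obtain ⟨t, ht, htn⟩ := hbot fun t ht => by
      rw [not_bddBelow_iff] at hb
      obtain ⟨r, hr, hrt⟩ := hb t
      exact (Ty r t t₀ hrt.le ht hr).trans hr
    have : cy t = cy t₀ := by
      rw [not_bddBelow_iff] at hb
      obtain ⟨r, hr, hrt⟩ := hb t
      exact (Ty r t t₀ hrt.le ht hr).trans hr
    exact absurd htn (not_lt.2 (H t this))
  set a := sInf K with ha
  have hglb : IsGLB K a := isGLB_csInf ⟨t₀, t₀K⟩ hbdd
  have hacl : a ∈ closure K := csInf_mem_closure ⟨t₀, t₀K⟩ hbdd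
  have haK : a ∉ K := by
    intro haK
    have h1 := Oy a (by rw [show cy a = cy t₀ from haK, ← h₀]; exact hnP)
    obtain ⟨ε, hε, hb⟩ := Metric.eventually_nhds_iff.1 h1
    have h2 := @hb (a - ε / 2) (by
      rw [Real.dist_eq, show a - ε / 2 - a = -(ε / 2) by ring, abs_neg, abs_of_pos (by linarith)]
      linarith)
    have h3 : a ≤ a - ε / 2 := hglb.1 (h2.trans haK)
    linarith
  have hfa : 0 ≤ fy a := by
    have hc : IsClosed {t | 0 ≤ fy t} := isClosed_le continuous_const hfy
    exact closure_minimal (fun t ht => H t ht) hc hacl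
  have haP : cy a ∈ P := by
    by_contra hn
    obtain ⟨t, ht, htK⟩ := mem_closure_iff_nhds.1 hacl _ (Oy a hn)
    exact haK ((show cy t = cy a from ht).symm.trans htK)
  have hat : a ≤ t₀ := hglb.1 t₀K
  obtain ⟨b, s', hbs, hb, hs'⟩ := hyx a t₀ hat
  have hbs₀ : b < s₀ := by
    by_contra! hle
    have := Tx s₀ b s' hle hbs (h₀.trans hs'.symm)
    exact haK (hb.symm.trans (this.trans h₀))
  have hbP : cx b ∈ P := hb ▸ haP
  have hfb : 0 ≤ fx b := by
    have h1 := hP b a hbP hb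
    rw [← sign_nonneg_iff, ← h1, sign_nonneg_iff] at hfa
    exact hfa
  obtain ⟨u, hu, hu'⟩ := exists_hasDerivAt_eq_slope fx fx' hbs₀
    (fun t _ => (dx t).continuousAt.continuousWithinAt) (fun t _ => dx t)
  have hune : cx u ≠ cx s₀ := fun h => by
    have h1 := pos u h
    rw [hu'] at h1
    have : (fx s₀ - fx b) / (s₀ - b) < 0 := div_neg_of_neg_of_pos (by linarith) (by linarith)
    linarith
  have hunb : cx u ≠ cx b := fun h => (hu.1.ne (Px b u hbP h.symm)).elim
  obtain ⟨b', u', hbu', hb', hu''⟩ := hxy b u hu.1.le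
  have hba : b' = a := (Py a b' haP (hb.symm.trans hb'.symm)).symm
  rw [hba] at hbu' hb'
  have hau : a < u' := lt_of_le_of_ne hbu' fun h => hunb (by rw [← hu'', ← h, hb'])
  obtain ⟨u₂, s₂, hus, hu₂, hs₂⟩ := hxy u s₀ hu.2.le
  obtain ⟨k, hkK, hku⟩ : ∃ k ∈ K, k < u' := by
    by_contra! hh
    exact absurd (hglb.2 hh) (not_le.2 hau)
  rcases le_total u' s₂ with h | h
  · have := Ty k u' s₂ hku.le h ((show cy k = cy t₀ from hkK).trans (h₀.symm.trans hs₂.symm))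
    exact hune (hu''.symm.trans (this.trans ((show cy k = cy t₀ from hkK).trans h₀.symm)))
  · have := Ty u₂ s₂ u' hus h (hu₂.trans hu''.symm)
    exact hune (hu₂.symm.trans (this.symm.trans hs₂))

/-- The mirror image of `exists_neg_of_matching`. -/
lemma exists_pos_of_matching {cx cy : ℝ → κ} {fx fy fx' : ℝ → ℝ} {P : Set κ}
    (Tx : ∀ s u t, s ≤ u → u ≤ t → cx s = cx t → cx u = cx s)
    (Ty : ∀ s u t, s ≤ u → u ≤ t → cy s = cy t → cy u = cy s)
    (hxy : ∀ s t, s ≤ t → ∃ s' t', s' ≤ t' ∧ cy s' = cx s ∧ cy t' = cx t)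
    (hyx : ∀ s t, s ≤ t → ∃ s' t', s' ≤ t' ∧ cx s' = cy s ∧ cx t' = cy t)
    (Px : ∀ s t, cx s ∈ P → cx s = cx t → s = t)
    (Py : ∀ s t, cy s ∈ P → cy s = cy t → s = t)
    (Oy : ∀ s, cy s ∉ P → ∀ᶠ t in nhds s, cy t = cy s)
    (hP : ∀ s t, cx s ∈ P → cx s = cy t → SignType.sign (fx s) = SignType.sign (fy t))
    (dx : ∀ t, HasDerivAt fx (fx' t) t) (hfy : Continuous fy)
    {s₀ t₀ : ℝ} (h₀ : cx s₀ = cy t₀) (hnP : cx s₀ ∉ P)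
    (pos : ∀ u, cx u = cx s₀ → 0 < fx' u)
    (htop : (∀ t ≥ t₀, cy t = cy t₀) → ∃ t ≥ t₀, 0 < fy t)
    (hpos : 0 < fx s₀) : ∃ t, cy t = cy t₀ ∧ 0 < fy t := by
  have key := exists_neg_of_matching (cx := fun t => cx (-t)) (cy := fun t => cy (-t))
    (fx := fun t => -fx (-t)) (fy := fun t => -fy (-t)) (fx' := fun t => fx' (-t)) (P := P)
    (fun s u t h1 h2 h => (Tx (-t) (-u) (-s) (by linarith) (by linarith) h.symm).trans h.symm)
    (fun s u t h1 h2 h => (Ty (-t) (-u) (-s) (by linarith) (by linarith) h.symm).trans h.symm)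
    (fun s t h => by
      obtain ⟨s', t', h1, h2, h3⟩ := hxy (-t) (-s) (by linarith)
      exact ⟨-t', -s', by linarith, by simpa using h3, by simpa using h2⟩)
    (fun s t h => by
      obtain ⟨s', t', h1, h2, h3⟩ := hyx (-t) (-s) (by linarith)
      exact ⟨-t', -s', by linarith, by simpa using h3, by simpa using h2⟩)
    (fun s t h1 h2 => neg_injective (Px _ _ h1 h2))
    (fun s t h1 h2 => neg_injective (Py _ _ h1 h2))
    (fun s h => (continuous_neg.tendsto s).eventually (Oy (-s) h))
    (fun s t h1 h2 => by
      simp only [Left.sign_neg]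
      rw [hP _ _ h1 h2])
    (fun t => by
      have h := ((dx (-t)).scomp t (hasDerivAt_neg t)).neg
      rwa [neg_smul, one_smul, neg_neg] at h)
    (by fun_prop) (s₀ := -s₀) (t₀ := -t₀) (by simpa using h₀) (by simpa using hnP)
    (fun u hu => pos (-u) (by simpa using hu))
    (fun h => by
      obtain ⟨t, h1, h2⟩ := htop fun t ht => by simpa using h (-t) (by linarith)
      exact ⟨-t, by linarith, by simpa using h2⟩)
    (by simpa using hpos)
  obtain ⟨t, h1, h2⟩ := key
  exact ⟨-t, by simpa using h1, by simpa using h2⟩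

/-- On corresponding open cells on which both functions are increasing, the ordered pairs of
signs realised by the two functions are the same. -/
lemma exists_pair_of_matching {cx cy : ℝ → κ} {fx fy fx' fy' : ℝ → ℝ} {P : Set κ}
    (Tx : ∀ s u t, s ≤ u → u ≤ t → cx s = cx t → cx u = cx s)
    (Ty : ∀ s u t, s ≤ u → u ≤ t → cy s = cy t → cy u = cy s)
    (hxy : ∀ s t, s ≤ t → ∃ s' t', s' ≤ t' ∧ cy s' = cx s ∧ cy t' = cx t)
    (hyx : ∀ s t, s ≤ t → ∃ s' t', s' ≤ t' ∧ cx s' = cy s ∧ cx t' = cy t)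
    (Px : ∀ s t, cx s ∈ P → cx s = cx t → s = t)
    (Py : ∀ s t, cy s ∈ P → cy s = cy t → s = t)
    (Ox : ∀ s, cx s ∉ P → ∀ᶠ t in nhds s, cx t = cx s)
    (Oy : ∀ s, cy s ∉ P → ∀ᶠ t in nhds s, cy t = cy s)
    (hP : ∀ s t, cx s ∈ P → cx s = cy t → SignType.sign (fx s) = SignType.sign (fy t))
    (dx : ∀ t, HasDerivAt fx (fx' t) t) (dy : ∀ t, HasDerivAt fy (fy' t) t)
    {s₀ t₀ : ℝ} (h₀ : cx s₀ = cy t₀) (hnP : cx s₀ ∉ P)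
    (posx : ∀ u, cx u = cx s₀ → 0 < fx' u) (posy : ∀ u, cy u = cy t₀ → 0 < fy' u)
    (hbot : ∀ t₁, cy t₁ = cy t₀ → (∀ t ≤ t₁, cy t = cy t₁) → ∃ t ≤ t₁, fy t < 0)
    (htop : ∀ t₁, cy t₁ = cy t₀ → (∀ t ≥ t₁, cy t = cy t₁) → ∃ t ≥ t₁, 0 < fy t)
    {s₁ : ℝ} (hs : s₀ ≤ s₁) (hs₁ : cx s₀ = cx s₁) :
    ∃ t t', t ≤ t' ∧ cy t = cx s₀ ∧ cy t' = cx s₁ ∧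
      SignType.sign (fy t) = SignType.sign (fx s₀) ∧
      SignType.sign (fy t') = SignType.sign (fx s₁) := by
  have hfy : Continuous fy := continuous_iff_continuousAt.2 fun t => (dy t).continuousAt
  have neg : ∀ s, cx s = cx s₀ → fx s < 0 → ∃ t, cy t = cx s₀ ∧ fy t < 0 := fun s h hn => by
    rw [h₀]
    exact exists_neg_of_matching Tx Ty hxy hyx Px Py Oy hP dx hfy (h.trans h₀) (h ▸ hnP)
      (fun u hu => posx u (hu.trans h)) (hbot t₀ rfl) hn
  have pos : ∀ s, cx s = cx s₀ → 0 < fx s → ∃ t, cy t = cx s₀ ∧ 0 < fy t := fun s h hn => by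
    rw [h₀]
    exact exists_pos_of_matching Tx Ty hxy hyx Px Py Oy hP dx hfy (h.trans h₀) (h ▸ hnP)
      (fun u hu => posx u (hu.trans h)) (htop t₀ rfl) hn
  have monox : ∀ s t, cx s = cx s₀ → cx t = cx s₀ → s < t → fx s < fx t := by
    intro s t h1 h2 hlt
    obtain ⟨u, hu, hu'⟩ := exists_hasDerivAt_eq_slope fx fx' hlt
      (fun t _ => (dx t).continuousAt.continuousWithinAt) (fun t _ => dx t)
    have h3 := posx u ((Tx s u t hu.1.le hu.2.le (h1.trans h2.symm)).trans h1)
    rw [hu', div_pos_iff_of_pos_right (by linarith)] at h3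
    linarith
  have monoy : ∀ s t, cy s = cy t₀ → cy t = cy t₀ → s < t → fy s < fy t := by
    intro s t h1 h2 hlt
    obtain ⟨u, hu, hu'⟩ := exists_hasDerivAt_eq_slope fy fy' hlt
      (fun t _ => (dy t).continuousAt.continuousWithinAt) (fun t _ => dy t)
    have h3 := posy u ((Ty s u t hu.1.le hu.2.le (h1.trans h2.symm)).trans h1)
    rw [hu', div_pos_iff_of_pos_right (by linarith)] at h3
    linarith
  have single : ∀ s, cx s = cx s₀ →
      ∃ t, cy t = cx s₀ ∧ SignType.sign (fy t) = SignType.sign (fx s) := by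
    intro s hs
    rcases lt_trichotomy (fx s) 0 with h | h | h
    · obtain ⟨t, h1, h2⟩ := neg s hs h
      exact ⟨t, h1, by rw [sign_neg h, sign_neg h2]⟩
    · obtain ⟨ε, hε, hb⟩ := Metric.eventually_nhds_iff.1 (Ox s (hs ▸ hnP))
      have h1 := @hb (s - ε / 2) (by
        rw [Real.dist_eq, show s - ε / 2 - s = -(ε / 2) by ring, abs_neg,
          abs_of_pos (by linarith)]
        linarith)
      have h2 := @hb (s + ε / 2) (by
        rw [Real.dist_eq, show s + ε / 2 - s = ε / 2 by ring, abs_of_pos (by linarith)]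
        linarith)
      obtain ⟨p, hp, hp'⟩ := neg _ (h1.trans hs)
        (h ▸ monox _ s (h1.trans hs) hs (by linarith))
      obtain ⟨q, hq, hq'⟩ := pos _ (h2.trans hs)
        (h ▸ monox s _ hs (h2.trans hs) (by linarith))
      have hpq : p ≤ q := by
        by_contra! hlt
        have := monoy q p (hq.trans h₀) (hp.trans h₀) hlt
        linarith
      obtain ⟨t, ht, ht'⟩ := intermediate_value_Icc hpq hfy.continuousOn
        (show (0 : ℝ) ∈ Set.Icc (fy p) (fy q) from ⟨hp'.le, hq'.le⟩)
      exact ⟨t, (Ty p t q ht.1 ht.2 (hp.trans hq.symm)).trans hp, by rw [ht', h]⟩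
    · obtain ⟨t, h1, h2⟩ := pos s hs h
      exact ⟨t, h1, by rw [sign_pos h, sign_pos h2]⟩
  obtain ⟨t, ht, ht'⟩ := single s₀ rfl
  obtain ⟨u, hu, hu'⟩ := single s₁ hs₁.symm
  by_cases heq : SignType.sign (fx s₀) = SignType.sign (fx s₁)
  · exact ⟨t, t, le_rfl, ht, ht.trans hs₁, ht', ht'.trans heq⟩
  · refine ⟨t, u, ?_, ht, hu.trans hs₁, ht', hu'⟩
    by_contra! hlt
    have hm := monoy u t (hu.trans h₀) (ht.trans h₀) hlt
    have hs' : s₀ < s₁ := lt_of_le_of_ne hs fun h => heq (by rw [h])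
    have hm' := monox s₀ s₁ rfl hs₁.symm hs'
    have h1 := SignType.sign.monotone hm.le
    have h2 := SignType.sign.monotone hm'.le
    rw [ht', hu'] at h1
    exact heq (le_antisymm h2 h1)

/-- Sign patterns matched cell by cell are matched globally. -/
lemma matching_of_cells {cx cy : ℝ → κ} {gx gy : ℝ → SignType}
    (Ty : ∀ s u t, s ≤ u → u ≤ t → cy s = cy t → cy u = cy s)
    (hxy : ∀ s t, s ≤ t → ∃ s' t', s' ≤ t' ∧ cy s' = cx s ∧ cy t' = cx t)
    (cell : ∀ s t, s ≤ t → cx s = cx t →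
      ∃ s' t', s' ≤ t' ∧ cy s' = cx s ∧ cy t' = cx t ∧ gy s' = gx s ∧ gy t' = gx t)
    (s t : ℝ) (hst : s ≤ t) :
    ∃ s' t', s' ≤ t' ∧ cy s' = cx s ∧ cy t' = cx t ∧ gy s' = gx s ∧ gy t' = gx t := by
  by_cases h : cx s = cx t
  · exact cell s t hst h
  obtain ⟨s', -, -, hs, -, hs', -⟩ := cell s s le_rfl rfl
  obtain ⟨t', -, -, ht, -, ht', -⟩ := cell t t le_rfl rfl
  refine ⟨s', t', ?_, hs, ht, hs', ht'⟩
  obtain ⟨s₁, t₁, hle, hs₁, ht₁⟩ := hxy s t hst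
  by_contra! hlt
  rcases le_total s₁ t' with h1 | h1
  · have := Ty s₁ t' s' h1 hlt.le (hs₁.trans hs.symm)
    exact h (hs₁.symm.trans (this.symm.trans ht))
  · have := Ty t' s₁ t₁ h1 hle (ht.trans ht₁.symm)
    exact h (hs₁.symm.trans (this.trans ht))

end Colorings

section Elimination

variable {A : Type*} [CommRing A]

/-- The sign at `t` of the specialisation of `f` along `x`. -/
noncomputable def signAt (x : A →+* ℝ) (f : Polynomial A) (t : ℝ) : SignType :=
  SignType.sign ((f.map x).eval t)

/-- The vector of signs at `t` of the specialisations along `x` of the members of `S`. -/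
noncomputable def signVector (S : Finset (Polynomial A)) (x : A →+* ℝ) (t : ℝ) :
    S → SignType :=
  fun f => signAt x f t

lemma signVector_eq_iff {S : Finset (Polynomial A)} {x y : A →+* ℝ} {s t : ℝ} :
    signVector S x s = signVector S y t ↔ ∀ f ∈ S, signAt x f s = signAt y f t := by
  simp [funext_iff, signVector]

/-- The sign conditions of `S` at `x` define order-convex sets. -/
def HasConvexCells (S : Finset (Polynomial A)) (x : A →+* ℝ) : Prop :=
  ∀ s u t, s ≤ u → u ≤ t → signVector S x s = signVector S x t →
    signVector S x u = signVector S x s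

/-- Every ordered pair of sign vectors realised at `x` is realised at `y`. -/
def SignsEmbed (S : Finset (Polynomial A)) (x y : A →+* ℝ) : Prop :=
  ∀ s t, s ≤ t → ∃ s' t', s' ≤ t' ∧ signVector S y s' = signVector S x s ∧
    signVector S y t' = signVector S x t

/-- The coefficients of members of `S` have the same signs at `x` and `y`. -/
def SameCoeffSigns (S : Finset (Polynomial A)) (x y : A →+* ℝ) : Prop :=
  ∀ f ∈ S, ∀ i, SignType.sign (x (f.coeff i)) = SignType.sign (y (f.coeff i))

/-- Closure under derivatives and pseudo-remainders by truncations. -/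
def IsElimClosed (S : Finset (Polynomial A)) : Prop :=
  (∀ f ∈ S, f.natDegree ≠ 0 → Polynomial.derivative f ∈ S) ∧
  ∀ f ∈ S, ∀ g ∈ S, g.natDegree ≤ f.natDegree → ∀ i, 1 ≤ i → i ≤ g.natDegree →
    ∃ r ∈ S, r.natDegree < i ∧ ∃ (k : ℕ) (q : Polynomial A),
      Polynomial.C (g.coeff i) ^ k * f =
        q * (∑ j ∈ Finset.range (i + 1), Polynomial.monomial j (g.coeff j)) + r

lemma SameCoeffSigns.symm {S : Finset (Polynomial A)} {x y : A →+* ℝ}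
    (h : SameCoeffSigns S x y) : SameCoeffSigns S y x := fun f hf i => (h f hf i).symm

lemma SameCoeffSigns.coeff_eq_zero_iff {S : Finset (Polynomial A)} {x y : A →+* ℝ}
    (h : SameCoeffSigns S x y) {f : Polynomial A} (hf : f ∈ S) (i : ℕ) :
    (f.map x).coeff i = 0 ↔ (f.map y).coeff i = 0 := by
  rw [Polynomial.coeff_map, Polynomial.coeff_map, ← sign_eq_zero_iff, h f hf i, sign_eq_zero_iff]

lemma SameCoeffSigns.map_eq_zero_iff {S : Finset (Polynomial A)} {x y : A →+* ℝ}
    (h : SameCoeffSigns S x y) {f : Polynomial A} (hf : f ∈ S) :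
    f.map x = 0 ↔ f.map y = 0 := by
  simp only [Polynomial.ext_iff, Polynomial.coeff_zero, h.coeff_eq_zero_iff hf]

lemma SameCoeffSigns.natDegree_eq {S : Finset (Polynomial A)} {x y : A →+* ℝ}
    (h : SameCoeffSigns S x y) {f : Polynomial A} (hf : f ∈ S) :
    (f.map x).natDegree = (f.map y).natDegree := by
  apply le_antisymm
  · rw [Polynomial.natDegree_le_iff_coeff_eq_zero]
    intro N hN
    rw [h.coeff_eq_zero_iff hf]
    exact Polynomial.coeff_eq_zero_of_natDegree_lt hN
  · rw [Polynomial.natDegree_le_iff_coeff_eq_zero]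
    intro N hN
    rw [← h.coeff_eq_zero_iff hf]
    exact Polynomial.coeff_eq_zero_of_natDegree_lt hN

/-- At a root of a nonzero specialisation, the sign of `f` is given by a pseudo-remainder. -/
lemma signAt_eq_of_root {S : Finset (Polynomial A)} {f g : Polynomial A} {x y : A →+* ℝ}
    (hrem : ∀ i, 1 ≤ i → i ≤ g.natDegree →
      ∃ r ∈ S, ∃ (k : ℕ) (q : Polynomial A), Polynomial.C (g.coeff i) ^ k * f =
        q * (∑ j ∈ Finset.range (i + 1), Polynomial.monomial j (g.coeff j)) + r)
    (hc : SameCoeffSigns S x y) (hg : g ∈ S) (hgx : g.map x ≠ 0) {s t : ℝ}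
    (hst : signVector S x s = signVector S y t) (hs : signAt x g s = 0) :
    signAt x f s = signAt y f t := by
  have hst' := signVector_eq_iff.1 hst
  have ht : signAt y g t = 0 := (hst' g hg).symm.trans hs
  rw [signAt, sign_eq_zero_iff] at hs ht
  have hpos : 1 ≤ (g.map x).natDegree := by
    by_contra! h
    have h0 : (g.map x).natDegree = 0 := by omega
    rw [Polynomial.eq_C_of_natDegree_eq_zero h0, Polynomial.eval_C] at hs
    exact hgx (by rw [Polynomial.eq_C_of_natDegree_eq_zero h0, hs, Polynomial.C_0])
  obtain ⟨r, hr, k, q, hq⟩ := hrem _ hpos Polynomial.natDegree_map_le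
  set i := (g.map x).natDegree with hi
  have key : ∀ (z : A →+* ℝ) (u : ℝ), (g.map z).natDegree = i → (g.map z).eval u = 0 →
      SignType.sign (z (g.coeff i)) ^ k * signAt z f u = signAt z r u := by
    intro z u hz hu
    have h1 := congrArg (fun p => (Polynomial.map z p).eval u) hq
    have h2 : (Polynomial.map z
        (∑ j ∈ Finset.range (i + 1), Polynomial.monomial j (g.coeff j))).eval u = 0 := by
      rw [Polynomial.eval_eq_sum_range, hz] at hu
      simpa [Polynomial.map_sum, Polynomial.eval_finsetSum] using hu
    simp only [Polynomial.map_add, Polynomial.map_mul, Polynomial.eval_add,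
      Polynomial.eval_mul, h2, mul_zero, zero_add, Polynomial.map_pow, Polynomial.map_C,
      Polynomial.eval_pow, Polynomial.eval_C] at h1
    rw [signAt, signAt, ← h1, sign_mul, sign_pow]
  have hx := key x s rfl hs
  have hy := key y t (hc.natDegree_eq hg).symm ht
  rw [← hst' r hr, ← hx, ← hc g hg i] at hy
  have hne : SignType.sign (x (g.coeff i)) ≠ 0 := by
    rw [Ne, sign_eq_zero_iff, ← Polynomial.coeff_map, hi]
    exact Polynomial.leadingCoeff_ne_zero.2 hgx
  exact (mul_left_cancel₀ (pow_ne_zero k hne) hy).symm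

lemma hasDerivAt_map_eval (x : A →+* ℝ) (f : Polynomial A) (t : ℝ) :
    HasDerivAt (fun t => (f.map x).eval t) ((f.derivative.map x).eval t) t := by
  rw [← Polynomial.derivative_map]
  exact (f.map x).hasDerivAt t

lemma sign_eventually_eq {x : A →+* ℝ} {f : Polynomial A} {s : ℝ}
    (h : f.map x = 0 ∨ signAt x f s ≠ 0) : ∀ᶠ t in nhds s, signAt x f t = signAt x f s := by
  rcases h with h | h
  · simp [signAt, h]
  · have hc : ContinuousAt (fun t => (f.map x).eval t) s := (f.map x).continuous.continuousAt
    rcases lt_trichotomy ((f.map x).eval s) 0 with h1 | h1 | h1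
    · filter_upwards [hc.eventually_lt_const h1] with t ht
      rw [signAt, signAt, sign_neg ht, sign_neg h1]
    · exact absurd (by rw [signAt, h1, sign_zero]) h
    · filter_upwards [hc.eventually_const_lt h1] with t ht
      rw [signAt, signAt, sign_pos ht, sign_pos h1]

lemma HasConvexCells.eq_of_root {S : Finset (Polynomial A)} {x : A →+* ℝ}
    (hT : HasConvexCells S x) {g : Polynomial A} (hg : g ∈ S) (hgx : g.map x ≠ 0) {s t : ℝ}
    (hs : signAt x g s = 0) (hst : signVector S x s = signVector S x t) : s = t := by
  have main : ∀ s t, signAt x g s = 0 → signVector S x s = signVector S x t → ¬ s < t := by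
    intro s t hs hst hlt
    apply hgx
    refine Polynomial.eq_zero_of_infinite_isRoot _ ((Set.Icc_infinite hlt).mono ?_)
    intro u hu
    have h := signVector_eq_iff.1 (hT s u t hu.1 hu.2 hst) g hg
    rw [hs, signAt, sign_eq_zero_iff] at h
    exact h
  rcases lt_trichotomy s t with h | h | h
  · exact absurd h (main s t hs hst)
  · exact h
  · refine absurd h (main t s ?_ hst.symm)
    rw [← signVector_eq_iff.1 hst g hg, hs]

lemma HasConvexCells.insert [DecidableEq (Polynomial A)] {S : Finset (Polynomial A)}
    {f : Polynomial A} {x : A →+* ℝ} (hT : HasConvexCells S x)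
    (hd : f.natDegree ≠ 0 → f.derivative ∈ S) : HasConvexCells (insert f S) x := by
  intro s u t hsu hut hst
  rw [signVector_eq_iff, Finset.forall_mem_insert] at hst ⊢
  have hS : ∀ v, s ≤ v → v ≤ t → ∀ g ∈ S, signAt x g v = signAt x g s := fun v h1 h2 =>
    signVector_eq_iff.1 (hT s v t h1 h2 (signVector_eq_iff.2 hst.2))
  refine ⟨?_, hS u hsu hut⟩
  by_cases h0 : f.natDegree = 0
  · rw [Polynomial.eq_C_of_natDegree_eq_zero h0]
    simp [signAt]
  have hder := fun v h1 h2 => hS v h1 h2 _ (hd h0)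
  have hcont : ContinuousOn (fun t => (f.map x).eval t) (Set.Icc s t) :=
    (f.map x).continuous.continuousOn
  have hdiff : ∀ v ∈ interior (Set.Icc s t), HasDerivWithinAt (fun t => (f.map x).eval t)
      ((f.derivative.map x).eval v) (interior (Set.Icc s t)) v :=
    fun v _ => (hasDerivAt_map_eval x f v).hasDerivWithinAt
  have hmem : s ∈ Set.Icc s t ∧ u ∈ Set.Icc s t ∧ t ∈ Set.Icc s t :=
    ⟨⟨le_rfl, hsu.trans hut⟩, ⟨hsu, hut⟩, ⟨hsu.trans hut, le_rfl⟩⟩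
  rcases le_total 0 ((f.derivative.map x).eval s) with h | h
  · have hm : MonotoneOn (fun t => (f.map x).eval t) (Set.Icc s t) := by
      refine monotoneOn_of_hasDerivWithinAt_nonneg (convex_Icc s t) hcont hdiff fun v hv => ?_
      rw [interior_Icc] at hv
      have := hder v hv.1.le hv.2.le
      rw [← sign_nonneg_iff] at h ⊢
      exact h.trans_eq this.symm
    refine le_antisymm ?_ (SignType.sign.monotone (hm hmem.1 hmem.2.1 hsu))
    rw [hst.1]
    exact SignType.sign.monotone (hm hmem.2.1 hmem.2.2 hut)
  · have hm : AntitoneOn (fun t => (f.map x).eval t) (Set.Icc s t) := by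
      refine antitoneOn_of_hasDerivWithinAt_nonpos (convex_Icc s t) hcont hdiff fun v hv => ?_
      rw [interior_Icc] at hv
      have := hder v hv.1.le hv.2.le
      rw [← sign_nonpos_iff] at h ⊢
      exact this.trans_le h
    refine le_antisymm (SignType.sign.monotone (hm hmem.1 hmem.2.1 hsu)) ?_
    rw [hst.1]
    exact SignType.sign.monotone (hm hmem.2.1 hmem.2.2 hut)

/-- A real polynomial bounded on a lower half-line is constant. -/
lemma Polynomial.natDegree_eq_zero_of_bounded_atBot {p : Polynomial ℝ} {a b c : ℝ}
    (h : ∀ t ≤ a, b ≤ p.eval t ∧ p.eval t ≤ c) : p.natDegree = 0 := by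
  have h1 : Filter.IsBoundedUnder (· ≤ ·) Filter.atTop
      fun t => |(p.comp (-Polynomial.X)).eval t| := by
    refine ⟨max |b| |c|, ?_⟩
    rw [Filter.eventually_map]
    filter_upwards [Filter.eventually_ge_atTop (-a)] with t ht
    have := h (-t) (by linarith)
    rw [Polynomial.eval_comp, Polynomial.eval_neg, Polynomial.eval_X]
    exact abs_le_max_abs_abs this.1 this.2
  rw [Polynomial.isBoundedUnder_abs_atTop_iff] at h1
  have h2 := Polynomial.natDegree_eq_zero_iff_degree_le_zero.2 h1
  rw [Polynomial.natDegree_comp] at h2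
  simpa using h2

lemma Polynomial.natDegree_eq_zero_of_bounded_atTop {p : Polynomial ℝ} {a b c : ℝ}
    (h : ∀ t ≥ a, b ≤ p.eval t ∧ p.eval t ≤ c) : p.natDegree = 0 := by
  have h2 := Polynomial.natDegree_eq_zero_of_bounded_atBot (p := p.comp (-Polynomial.X))
    (a := -a) (b := b) (c := c) fun t ht => by
      rw [Polynomial.eval_comp, Polynomial.eval_neg, Polynomial.eval_X]
      exact h (-t) (by linarith)
  rw [Polynomial.natDegree_comp] at h2
  simpa using h2

/-- A real polynomial with positive derivative on a lower half-line takes negative values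
there. -/
lemma Polynomial.exists_neg_of_derivative_pos {p : Polynomial ℝ} {a : ℝ}
    (h : ∀ t ≤ a, 0 < p.derivative.eval t) : ∃ t ≤ a, p.eval t < 0 := by
  by_contra! H
  have hm : MonotoneOn (fun t => p.eval t) (Set.Iic a) :=
    monotoneOn_of_hasDerivWithinAt_nonneg (convex_Iic a) p.continuous.continuousOn
      (fun v _ => (p.hasDerivAt v).hasDerivWithinAt)
      fun v hv => (h v (Set.mem_Iic.1 (interior_subset hv))).le
  have h0 := Polynomial.natDegree_eq_zero_of_bounded_atBot (p := p) (a := a) (b := 0)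
    (c := p.eval a) fun t ht => ⟨H t ht, hm ht Set.self_mem_Iic ht⟩
  have := h a le_rfl
  rw [Polynomial.eq_C_of_natDegree_eq_zero h0] at this
  simp at this

lemma Polynomial.exists_pos_of_derivative_pos {p : Polynomial ℝ} {a : ℝ}
    (h : ∀ t ≥ a, 0 < p.derivative.eval t) : ∃ t ≥ a, 0 < p.eval t := by
  by_contra! H
  have hm : MonotoneOn (fun t => p.eval t) (Set.Ici a) :=
    monotoneOn_of_hasDerivWithinAt_nonneg (convex_Ici a) p.continuous.continuousOn
      (fun v _ => (p.hasDerivAt v).hasDerivWithinAt)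
      fun v hv => (h v (Set.mem_Ici.1 (interior_subset hv))).le
  have h0 := Polynomial.natDegree_eq_zero_of_bounded_atTop (p := p) (a := a) (b := p.eval a)
    (c := 0) fun t ht => ⟨hm Set.self_mem_Ici ht ht, H t ht⟩
  have := h a le_rfl
  rw [Polynomial.eq_C_of_natDegree_eq_zero h0] at this
  simp at this

/-- The cells of `S` at `x` that are single points because a nonzero polynomial vanishes. -/
def rootVectors (S : Finset (Polynomial A)) (x : A →+* ℝ) : Set (S → SignType) :=
  {σ | ∃ g : S, (g : Polynomial A).map x ≠ 0 ∧ σ g = 0}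

lemma SameCoeffSigns.rootVectors_eq {S : Finset (Polynomial A)} {x y : A →+* ℝ}
    (h : SameCoeffSigns S x y) : rootVectors S x = rootVectors S y := by
  ext σ
  simp only [rootVectors, Set.mem_ofPred_eq, Ne, h.map_eq_zero_iff (Subtype.coe_prop _)]

lemma signVector_eventually_eq {S : Finset (Polynomial A)} {x : A →+* ℝ} {s : ℝ}
    (h : signVector S x s ∉ rootVectors S x) :
    ∀ᶠ t in nhds s, signVector S x t = signVector S x s := by
  simp only [signVector_eq_iff]
  rw [Filter.eventually_all_finset]
  intro f hf
  apply sign_eventually_eq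
  by_contra! hn
  exact h ⟨⟨f, hf⟩, hn.1, hn.2⟩

lemma HasConvexCells.eq_of_mem_rootVectors {S : Finset (Polynomial A)} {x : A →+* ℝ}
    (hT : HasConvexCells S x) {s t : ℝ} (hs : signVector S x s ∈ rootVectors S x)
    (hst : signVector S x s = signVector S x t) : s = t := by
  obtain ⟨g, hg, h0⟩ := hs
  exact hT.eq_of_root g.2 hg h0 hst

/-- On an open cell a polynomial is either constant or strictly monotone; in either case the
signs it takes are determined by sign data at `x`. -/
lemma exists_pair_of_cell [DecidableEq (Polynomial A)]
    {S : Finset (Polynomial A)} {f : Polynomial A} {x y : A →+* ℝ}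
    (hd : f.natDegree ≠ 0 → f.derivative ∈ S)
    (hrem : ∀ g ∈ S, ∀ i, 1 ≤ i → i ≤ g.natDegree →
      ∃ r ∈ S, ∃ (k : ℕ) (q : Polynomial A), Polynomial.C (g.coeff i) ^ k * f =
        q * (∑ j ∈ Finset.range (i + 1), Polynomial.monomial j (g.coeff j)) + r)
    (hc : SameCoeffSigns (insert f S) x y)
    (Tx : HasConvexCells S x) (Ty : HasConvexCells S y)
    (hxy : SignsEmbed S x y) (hyx : SignsEmbed S y x)
    (s t : ℝ) (hst : s ≤ t) (hcell : signVector S x s = signVector S x t) :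
    ∃ s' t', s' ≤ t' ∧ signVector S y s' = signVector S x s ∧
      signVector S y t' = signVector S x t ∧ signAt y f s' = signAt x f s ∧
      signAt y f t' = signAt x f t := by
  have hcS : SameCoeffSigns S x y := fun g hg => hc g (Finset.mem_insert_of_mem hg)
  obtain ⟨s', -, -, hs', -⟩ := hxy s s le_rfl
  have hP : ∀ u v, signVector S x u ∈ rootVectors S x → signVector S x u = signVector S y v →
      signAt x f u = signAt y f v := by
    rintro u v ⟨g, hg, h0⟩ huv
    exact signAt_eq_of_root (hrem g g.2) hcS g.2 hg huv h0
  by_cases hroot : signVector S x s ∈ rootVectors S x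
  · obtain rfl := Tx.eq_of_mem_rootVectors hroot hcell
    have := (hP s s' hroot hs'.symm).symm
    exact ⟨s', s', le_rfl, hs', hs', this, this⟩
  have hconst : f.natDegree = 0 ∨ f.derivative.map x = 0 →
      ∀ u v, signAt y f v = signAt x f u := by
    intro h u v
    have hx : (f.map x).natDegree = 0 := by
      rcases h with h | h
      · exact Nat.le_zero.1 (Polynomial.natDegree_map_le.trans h.le)
      · rw [← Polynomial.derivative_map] at h
        exact Polynomial.derivative_eq_zero.1 h
    have hy : (f.map y).natDegree = 0 := by
      rw [← hc.natDegree_eq (Finset.mem_insert_self f S), hx]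
    rw [signAt, signAt, Polynomial.eq_C_of_natDegree_eq_zero hx,
      Polynomial.eq_C_of_natDegree_eq_zero hy, Polynomial.eval_C, Polynomial.eval_C,
      Polynomial.coeff_map, Polynomial.coeff_map, hc f (Finset.mem_insert_self f S)]
  by_cases hf0 : f.natDegree = 0 ∨ f.derivative.map x = 0
  · have := hconst hf0
    exact ⟨s', s', le_rfl, hs', hs'.trans hcell, this _ _, this _ _⟩
  push Not at hf0
  have hdS := hd hf0.1
  have hdne : signAt x f.derivative s ≠ 0 := fun h => hroot ⟨⟨_, hdS⟩, hf0.2, h⟩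
  have hder : ∀ (z : A →+* ℝ) u, signVector S z u = signVector S x s →
      signAt z f.derivative u = signAt x f.derivative s :=
    fun z u h => signVector_eq_iff.1 h _ hdS
  have hO := hcS.rootVectors_eq
  have Ox : ∀ s, signVector S x s ∉ rootVectors S x →
      ∀ᶠ t in nhds s, signVector S x t = signVector S x s := fun _ => signVector_eventually_eq
  have Oy : ∀ s, signVector S y s ∉ rootVectors S x →
      ∀ᶠ t in nhds s, signVector S y t = signVector S y s := by
    rw [hO]; exact fun _ => signVector_eventually_eq
  have Px : ∀ s t, signVector S x s ∈ rootVectors S x →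
      signVector S x s = signVector S x t → s = t := fun _ _ => Tx.eq_of_mem_rootVectors
  have Py : ∀ s t, signVector S y s ∈ rootVectors S x →
      signVector S y s = signVector S y t → s = t := by
    rw [hO]; exact fun _ _ => Ty.eq_of_mem_rootVectors
  rcases lt_or_gt_of_ne hdne with hneg | hpos
  · have hlt : ∀ (z : A →+* ℝ) u, signVector S z u = signVector S x s →
        0 < -((f.derivative.map z).eval u) := fun z u h => by
      have := (hder z u h).trans_lt hneg
      rw [signAt, ← not_le, sign_nonneg_iff, not_le] at this
      linarith
    obtain ⟨t₁, t₂, h12, h1, h2, h3, h4⟩ := exists_pair_of_matching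
      (fx := fun t => -(f.map x).eval t) (fy := fun t => -(f.map y).eval t)
      Tx Ty hxy hyx Px Py Ox Oy
      (fun u v hu huv => by
        have := hP u v hu huv
        simp only [signAt] at this
        rw [Left.sign_neg, Left.sign_neg, this])
      (fun t => (hasDerivAt_map_eval x f t).neg) (fun t => (hasDerivAt_map_eval y f t).neg)
      hs'.symm hroot (hlt x) (fun u hu => hlt y u (hu.trans hs'))
      (fun t₁ ht₁ h => by
        have := Polynomial.exists_neg_of_derivative_pos (p := -(f.map y)) (a := t₁)
          fun t ht => by
            rw [Polynomial.derivative_neg, Polynomial.derivative_map, Polynomial.eval_neg]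
            exact hlt y t ((h t ht).trans (ht₁.trans hs'))
        simpa only [Polynomial.eval_neg] using this)
      (fun t₁ ht₁ h => by
        have := Polynomial.exists_pos_of_derivative_pos (p := -(f.map y)) (a := t₁)
          fun t ht => by
            rw [Polynomial.derivative_neg, Polynomial.derivative_map, Polynomial.eval_neg]
            exact hlt y t ((h t ht).trans (ht₁.trans hs'))
        simpa only [Polynomial.eval_neg] using this) hst hcell
    rw [Left.sign_neg, Left.sign_neg, neg_inj] at h3 h4
    exact ⟨t₁, t₂, h12, h1, h2, h3, h4⟩
  · have hlt : ∀ (z : A →+* ℝ) u, signVector S z u = signVector S x s →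
        0 < ((f.derivative.map z).eval u) := fun z u h => by
      have : 0 < signAt z f.derivative u := hpos.trans_eq (hder z u h).symm
      rwa [signAt, ← not_le, sign_nonpos_iff, not_le] at this
    exact exists_pair_of_matching Tx Ty hxy hyx Px Py Ox Oy hP
      (hasDerivAt_map_eval x f) (hasDerivAt_map_eval y f) hs'.symm hroot (hlt x)
      (fun u hu => hlt y u (hu.trans hs'))
      (fun t₁ ht₁ h => Polynomial.exists_neg_of_derivative_pos fun t ht => by
        rw [Polynomial.derivative_map]
        exact hlt y t ((h t ht).trans (ht₁.trans hs')))
      (fun t₁ ht₁ h => Polynomial.exists_pos_of_derivative_pos fun t ht => by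
        rw [Polynomial.derivative_map]
        exact hlt y t ((h t ht).trans (ht₁.trans hs'))) hst hcell

/-- Thom's lemma together with Hörmander's elimination step for an elimination-closed family. -/
lemma IsElimClosed.convex_and_embed {S : Finset (Polynomial A)} (hS : IsElimClosed S) :
    (∀ x : A →+* ℝ, HasConvexCells S x) ∧
      ∀ x y : A →+* ℝ, SameCoeffSigns S x y → SignsEmbed S x y := by
  classical
  revert hS
  refine Finset.induction_on_max_value Polynomial.natDegree (motive := fun S =>
    IsElimClosed S → (∀ x : A →+* ℝ, HasConvexCells S x) ∧
      ∀ x y : A →+* ℝ, SameCoeffSigns S x y → SignsEmbed S x y) S ?_ ?_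
  · intro hS
    refine ⟨fun x s u t _ _ _ => signVector_eq_iff.2 (by simp), fun x y _ s t hst =>
      ⟨s, t, hst, signVector_eq_iff.2 (by simp), signVector_eq_iff.2 (by simp)⟩⟩
  · intro f S hfS hmax ih hS
    have hd : f.natDegree ≠ 0 → f.derivative ∈ S := fun h => by
      refine (Finset.mem_insert.1 (hS.1 f (Finset.mem_insert_self f S) h)).resolve_left fun he => ?_
      have := Polynomial.natDegree_derivative_lt h
      rw [he] at this
      exact lt_irrefl _ this
    have hrem : ∀ f' ∈ insert f S, ∀ g ∈ S, g.natDegree ≤ f'.natDegree →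
        ∀ i, 1 ≤ i → i ≤ g.natDegree → ∃ r ∈ S, r.natDegree < i ∧
        ∃ (k : ℕ) (q : Polynomial A), Polynomial.C (g.coeff i) ^ k * f' =
          q * (∑ j ∈ Finset.range (i + 1), Polynomial.monomial j (g.coeff j)) + r := by
      intro f' hf' g hg hle i h1 hi
      obtain ⟨r, hr, hri, h⟩ := hS.2 f' hf' g (Finset.mem_insert_of_mem hg) hle i h1 hi
      refine ⟨r, (Finset.mem_insert.1 hr).resolve_left ?_, hri, h⟩
      rintro rfl
      have := hmax g hg
      omega
    have hS' : IsElimClosed S := by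
      refine ⟨fun g hg h => ?_, fun f' hf' => hrem f' (Finset.mem_insert_of_mem hf')⟩
      refine (Finset.mem_insert.1 (hS.1 g (Finset.mem_insert_of_mem hg) h)).resolve_left
        fun he => ?_
      have h1 := Polynomial.natDegree_derivative_lt h
      rw [he] at h1
      exact absurd (hmax g hg) (not_le.2 h1)
    obtain ⟨ihT, ihE⟩ := ih hS'
    refine ⟨fun x => (ihT x).insert hd, fun x y hc s t hst => ?_⟩
    have hcS : SameCoeffSigns S x y := fun g hg => hc g (Finset.mem_insert_of_mem hg)
    obtain ⟨s', t', h0, h1, h2, h3, h4⟩ := matching_of_cells (ihT y) (ihE x y hcS)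
      (exists_pair_of_cell hd (fun g hg i h1 hi => by
        obtain ⟨r, hr, -, h⟩ := hrem f (Finset.mem_insert_self f S) g hg (hmax g hg) i h1 hi
        exact ⟨r, hr, h⟩) hc (ihT x) (ihT y) (ihE x y hcS) (ihE y x hcS.symm)) s t hst
    rw [signVector_eq_iff] at h1 h2
    refine ⟨s', t', h0, ?_, ?_⟩
    · rw [signVector_eq_iff, Finset.forall_mem_insert]
      exact ⟨h3, h1⟩
    · rw [signVector_eq_iff, Finset.forall_mem_insert]
      exact ⟨h4, h2⟩

/-- Pseudo-division. -/
lemma exists_pseudo_remainder (g : ℕ → A) {i : ℕ} (hi : 1 ≤ i) (f : Polynomial A) :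
    ∃ r : Polynomial A, r.natDegree < i ∧ ∃ (k : ℕ) (q : Polynomial A),
      Polynomial.C (g i) ^ k * f =
        q * (∑ j ∈ Finset.range (i + 1), Polynomial.monomial j (g j)) + r := by
  suffices H : ∀ (d : ℕ) (f : Polynomial A), f.natDegree < d →
      ∃ r : Polynomial A, r.natDegree < i ∧ ∃ (k : ℕ) (q : Polynomial A),
      Polynomial.C (g i) ^ k * f =
        q * (∑ j ∈ Finset.range (i + 1), Polynomial.monomial j (g j)) + r from
    H _ f (Nat.lt_succ_self _)
  intro d
  induction d with
  | zero => intro f hf; omega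
  | succ d ih =>
    intro f hf
    by_cases hfi : f.natDegree < i
    · exact ⟨f, hfi, 0, 0, by simp⟩
    push Not at hfi
    set h := ∑ j ∈ Finset.range (i + 1), Polynomial.monomial j (g j) with hh
    have hdeg : h.natDegree ≤ i := by
      refine Polynomial.natDegree_sum_le_of_forall_le _ _ fun j hj => ?_
      exact (Polynomial.natDegree_monomial_le _).trans (by simp at hj; omega)
    have hcoeff : h.coeff i = g i := by
      simp [hh, Polynomial.coeff_monomial]
    set f₁ := Polynomial.C (g i) * f -
      Polynomial.monomial (f.natDegree - i) f.leadingCoeff * h with hf₁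
    have hlt : f₁.natDegree < d := by
      have hle : f₁.natDegree ≤ f.natDegree := by
        refine (Polynomial.natDegree_sub_le _ _).trans (max_le ?_ ?_)
        · exact Polynomial.natDegree_C_mul_le _ _
        · refine Polynomial.natDegree_mul_le.trans ?_
          have := Polynomial.natDegree_monomial_le (m := f.natDegree - i) f.leadingCoeff
          omega
      have htop : f₁.coeff f.natDegree = 0 := by
        have hlead : (Polynomial.monomial (f.natDegree - i) f.leadingCoeff * h).coeff
            f.natDegree = f.leadingCoeff * h.coeff i := by
          obtain ⟨e, he⟩ := Nat.exists_eq_add_of_le hfi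
          rw [he, Nat.add_sub_cancel_left, Polynomial.coeff_monomial_mul]
        rw [hf₁, Polynomial.coeff_sub, Polynomial.coeff_C_mul, hlead]
        rw [hcoeff, Polynomial.leadingCoeff]
        ring
      rcases hle.lt_or_eq with hl | he
      · omega
      · have h0 : f₁ = 0 := by
          rw [← Polynomial.leadingCoeff_eq_zero, Polynomial.leadingCoeff, he, htop]
        rw [h0, Polynomial.natDegree_zero] at he
        omega
    obtain ⟨r, hr, k, q, hq⟩ := ih f₁ hlt
    refine ⟨r, hr, k + 1,
      q + Polynomial.C (g i) ^ k * Polynomial.monomial (f.natDegree - i) f.leadingCoeff, ?_⟩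
    rw [hf₁] at hq
    linear_combination hq

/-- Every finite family is contained in an elimination-closed one. -/
lemma exists_isElimClosed (F : Finset (Polynomial A)) :
    ∃ S : Finset (Polynomial A), F ⊆ S ∧ IsElimClosed S := by
  classical
  suffices H : ∀ (m : ℕ) (F : Finset (Polynomial A)),
      (∀ f ∈ F, f.natDegree ≠ 0 → m ≤ f.natDegree → Polynomial.derivative f ∈ F) →
      (∀ f ∈ F, ∀ g ∈ F, g.natDegree ≤ f.natDegree → m ≤ g.natDegree →
        ∀ i, 1 ≤ i → i ≤ g.natDegree →
        ∃ r ∈ F, r.natDegree < i ∧ ∃ (k : ℕ) (q : Polynomial A),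
        Polynomial.C (g.coeff i) ^ k * f =
          q * (∑ j ∈ Finset.range (i + 1), Polynomial.monomial j (g.coeff j)) + r) →
      ∃ S : Finset (Polynomial A), F ⊆ S ∧ IsElimClosed S by
    have hb : ∀ f ∈ F, f.natDegree < F.sup Polynomial.natDegree + 1 := fun f hf =>
      Nat.lt_succ_of_le (Finset.le_sup (f := Polynomial.natDegree) hf)
    exact H (F.sup Polynomial.natDegree + 1) F
      (fun f hf _ h => absurd (hb f hf) (not_lt.2 h))
      (fun f hf g hg _ h => absurd (hb g hg) (not_lt.2 h))
  intro m
  induction m with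
  | zero => exact fun F h1 h2 => ⟨F, subset_rfl, fun f hf h => h1 f hf h (Nat.zero_le _),
      fun f hf g hg h => h2 f hf g hg h (Nat.zero_le _)⟩
  | succ m ih =>
    intro F h1 h2
    have hrem : ∀ (f g : Polynomial A) (i : ℕ), ∃ r : Polynomial A, 1 ≤ i → (r.natDegree < i ∧
        ∃ (k : ℕ) (q : Polynomial A), Polynomial.C (g.coeff i) ^ k * f =
          q * (∑ j ∈ Finset.range (i + 1), Polynomial.monomial j (g.coeff j)) + r) := by
      intro f g i
      by_cases hi : 1 ≤ i
      · obtain ⟨r, hr⟩ := exists_pseudo_remainder g.coeff hi f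
        exact ⟨r, fun _ => hr⟩
      · exact ⟨0, fun h => absurd h hi⟩
    choose R hR using hrem
    set D := (F.filter fun f => f.natDegree = m ∧ f.natDegree ≠ 0).image
      Polynomial.derivative with hD
    set E := (F ×ˢ (F.filter fun g => g.natDegree = m) ×ˢ Finset.Icc 1 m).image
      (fun p => R p.1 p.2.1 p.2.2) with hE
    have hDdeg : ∀ f ∈ D, f.natDegree < m := by
      intro f hf
      simp only [hD, Finset.mem_image, Finset.mem_filter] at hf
      obtain ⟨g, ⟨_, hg, hg0⟩, rfl⟩ := hf
      exact hg ▸ Polynomial.natDegree_derivative_lt hg0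
    have hEdeg : ∀ f ∈ E, f.natDegree < m := by
      intro f hf
      simp only [hE, Finset.mem_image, Finset.mem_product, Finset.mem_filter,
        Finset.mem_Icc] at hf
      obtain ⟨⟨f', g, i⟩, ⟨_, _, hi⟩, rfl⟩ := hf
      exact ((hR f' g i hi.1).1).trans_le hi.2
    have hold : ∀ f ∈ F ∪ (D ∪ E), m ≤ f.natDegree → f ∈ F := by
      intro f hf hm
      rcases Finset.mem_union.1 hf with h | h
      · exact h
      rcases Finset.mem_union.1 h with h | h
      · exact absurd (hDdeg f h) (not_lt.2 hm)
      · exact absurd (hEdeg f h) (not_lt.2 hm)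
    obtain ⟨S, hS, hcl⟩ := ih (F ∪ (D ∪ E))
      (fun f hf h0 hm => by
        have hfF := hold f hf hm
        rcases hm.lt_or_eq with hlt | heq
        · exact Finset.mem_union_left _ (h1 f hfF h0 hlt)
        · exact Finset.mem_union_right _ (Finset.mem_union_left _
            (Finset.mem_image_of_mem _ (Finset.mem_filter.2 ⟨hfF, heq.symm, h0⟩))))
      (fun f hf g hg hle hm i hi1 hi2 => by
        have hgF := hold g hg hm
        have hfF := hold f hf (hm.trans hle)
        rcases hm.lt_or_eq with hlt | heq
        · obtain ⟨r, hr, h⟩ := h2 f hfF g hgF hle hlt i hi1 hi2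
          exact ⟨r, Finset.mem_union_left _ hr, h⟩
        · refine ⟨R f g i, Finset.mem_union_right _ (Finset.mem_union_right _ ?_),
            hR f g i hi1⟩
          refine Finset.mem_image.2 ⟨(f, g, i), ?_, rfl⟩
          simp only [Finset.mem_product, Finset.mem_filter, Finset.mem_Icc]
          exact ⟨hfF, ⟨hgF, heq.symm⟩, hi1, hi2.trans heq.symm.le⟩)
    exact ⟨S, Finset.subset_union_left.trans hS, hcl⟩

end Elimination

section SignSets

variable {σ τ : Type}

/-- The members of `F` have the same signs at `x` and `y`. -/
def SameSigns (F : Finset (MvPolynomial σ ℝ)) (x y : σ → ℝ) : Prop :=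
  ∀ f ∈ F, SignType.sign (eval x f) = SignType.sign (eval y f)

/-- Membership in `A` is determined by the signs of finitely many polynomials. -/
def IsSignDetermined (A : Set (σ → ℝ)) : Prop :=
  ∃ F : Finset (MvPolynomial σ ℝ), ∀ x y, SameSigns F x y → x ∈ A → y ∈ A

lemma SameSigns.symm {F : Finset (MvPolynomial σ ℝ)} {x y : σ → ℝ} (h : SameSigns F x y) :
    SameSigns F y x := fun f hf => (h f hf).symm

lemma SameSigns.trans {F : Finset (MvPolynomial σ ℝ)} {x y z : σ → ℝ} (h : SameSigns F x y)
    (h' : SameSigns F y z) : SameSigns F x z := fun f hf => (h f hf).trans (h' f hf)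

lemma SameSigns.mono {F F' : Finset (MvPolynomial σ ℝ)} (hF : F ⊆ F') {x y : σ → ℝ}
    (h : SameSigns F' x y) : SameSigns F x y := fun f hf => h f (hF hf)

/-- The point of `Option σ → ℝ` with coordinate `t` at `none` and `x` elsewhere. -/
def consPoint (t : ℝ) (x : σ → ℝ) : Option σ → ℝ := fun o => o.elim t x

lemma eval_optionEquivLeft (f : MvPolynomial (Option σ) ℝ) (t : ℝ) (x : σ → ℝ) :
    ((optionEquivLeft ℝ σ f).map (eval x)).eval t = eval (consPoint t x) f := by
  induction f using MvPolynomial.induction_on with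
  | C a => simp [optionEquivLeft_C]
  | add p q hp hq => simp only [map_add, Polynomial.map_add, Polynomial.eval_add, hp, hq]
  | mul_X p i hp =>
    rw [map_mul, Polynomial.map_mul, Polynomial.eval_mul, hp, map_mul]
    cases i <;> simp [optionEquivLeft_X_none, optionEquivLeft_X_some, consPoint]

lemma eval_optionEquivLeft_symm (f : Polynomial (MvPolynomial σ ℝ)) (t : ℝ) (x : σ → ℝ) :
    eval (consPoint t x) ((optionEquivLeft ℝ σ).symm f) = (f.map (eval x)).eval t := by
  rw [← eval_optionEquivLeft, AlgEquiv.apply_symm_apply]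

/-- All coefficients of the members of a finite family of polynomials. -/
noncomputable def allCoeffs {A : Type*} [CommRing A] (L : Finset (Polynomial A)) : Finset A := by
  classical
  exact L.biUnion fun f => f.support.image f.coeff

lemma coeff_mem_allCoeffs {A : Type*} [CommRing A] {L : Finset (Polynomial A)}
    {f : Polynomial A} (hf : f ∈ L) {i : ℕ} (hi : f.coeff i ≠ 0) : f.coeff i ∈ allCoeffs L := by
  classical
  rw [allCoeffs, Finset.mem_biUnion]
  exact ⟨f, hf, Finset.mem_image_of_mem _ (Polynomial.mem_support_iff.2 hi)⟩

lemma sameCoeffSigns_of_sameSigns {L : Finset (Polynomial (MvPolynomial σ ℝ))} {x y : σ → ℝ}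
    (h : SameSigns (allCoeffs L) x y) : SameCoeffSigns L (eval x) (eval y) := by
  intro f hf i
  by_cases hi : f.coeff i = 0
  · simp [hi]
  · exact h _ (coeff_mem_allCoeffs hf hi)

/-- The projection forgetting one coordinate preserves sign-determined sets. -/
lemma IsSignDetermined.exists_consPoint {A : Set (Option σ → ℝ)} (hA : IsSignDetermined A) :
    IsSignDetermined {x : σ → ℝ | ∃ t, consPoint t x ∈ A} := by
  classical
  obtain ⟨F, hF⟩ := hA
  obtain ⟨L, hFL, hL⟩ := exists_isElimClosed (F.image (optionEquivLeft ℝ σ))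
  refine ⟨allCoeffs L, ?_⟩
  rintro x y hxy ⟨t, ht⟩
  obtain ⟨t', -, -, h, -⟩ := hL.convex_and_embed.2 _ _ (sameCoeffSigns_of_sameSigns hxy) t t le_rfl
  refine ⟨t', hF _ _ (fun f hf => ?_) ht⟩
  have := signVector_eq_iff.1 h _ (hFL (Finset.mem_image_of_mem _ hf))
  rw [signAt, signAt, eval_optionEquivLeft, eval_optionEquivLeft] at this
  exact this.symm

lemma IsSignDetermined.preimage {A : Set (τ → ℝ)} (hA : IsSignDetermined A)
    (P : τ → MvPolynomial σ ℝ) : IsSignDetermined {x : σ → ℝ | (fun i => eval x (P i)) ∈ A} := by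
  classical
  obtain ⟨F, hF⟩ := hA
  refine ⟨F.image (bind₁ P), fun x y hxy hx => hF _ _ (fun f hf => ?_) hx⟩
  have := hxy _ (Finset.mem_image_of_mem _ hf)
  simpa only [eval, eval₂Hom_bind₁] using this

lemma IsSignDetermined.inter {A B : Set (σ → ℝ)} (hA : IsSignDetermined A)
    (hB : IsSignDetermined B) : IsSignDetermined (A ∩ B) := by
  classical
  obtain ⟨F, hF⟩ := hA
  obtain ⟨F', hF'⟩ := hB
  exact ⟨F ∪ F', fun x y hxy hx => ⟨hF x y (hxy.mono Finset.subset_union_left) hx.1,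
    hF' x y (hxy.mono Finset.subset_union_right) hx.2⟩⟩

lemma isSignDetermined_zeros (F : Finset (MvPolynomial σ ℝ)) :
    IsSignDetermined {x : σ → ℝ | ∀ f ∈ F, eval x f = 0} := by
  refine ⟨F, fun x y hxy hx f hf => ?_⟩
  have := hxy f hf
  rwa [hx f hf, sign_zero, eq_comm, sign_eq_zero_iff] at this

/-- Tarski–Seidenberg: projections of sign-determined sets are sign-determined. -/
lemma IsSignDetermined.exists_sumElim [Finite σ] {A : Set (σ ⊕ τ → ℝ)}
    (hA : IsSignDetermined A) : IsSignDetermined {z : τ → ℝ | ∃ w, Sum.elim w z ∈ A} := by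
  suffices H : ∀ A : Set (σ ⊕ τ → ℝ), IsSignDetermined A →
    IsSignDetermined {z : τ → ℝ | ∃ w, Sum.elim w z ∈ A} from H A hA
  refine Finite.induction_empty_option (P := fun σ => ∀ A : Set (σ ⊕ τ → ℝ), IsSignDetermined A →
    IsSignDetermined {z : τ → ℝ | ∃ w, Sum.elim w z ∈ A}) ?_ ?_ ?_ σ
  · intro α β e h A hA
    have h1 := h _ (hA.preimage (σ := α ⊕ τ) (fun i => X (Sum.map e.symm id i)))
    convert h1 using 1
    ext z
    simp only [Set.mem_ofPred_eq, eval_X]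
    constructor
    · rintro ⟨w, hw⟩
      refine ⟨w ∘ e, ?_⟩
      convert hw using 1
      ext (i | i) <;> simp
    · rintro ⟨w, hw⟩
      refine ⟨w ∘ e.symm, ?_⟩
      convert hw using 1
      ext (i | i) <;> simp
  · intro A hA
    have h1 := hA.preimage (σ := τ) (Sum.elim PEmpty.elim X)
    convert h1 using 1
    ext z
    simp only [Set.mem_ofPred_eq]
    constructor
    · rintro ⟨w, hw⟩
      convert hw using 1
      ext (i | i)
      · exact i.elim
      · simp
    · intro hw
      refine ⟨PEmpty.elim, ?_⟩
      convert hw using 1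
      ext (i | i)
      · exact i.elim
      · simp
  · intro α _ h A hA
    have h1 := h _ (hA.preimage (σ := Option (α ⊕ τ)) (Sum.elim
      (fun o => X (o.elim none fun i => some (Sum.inl i)))
      fun i => X (some (Sum.inr i)))).exists_consPoint
    convert h1 using 1
    ext z
    simp only [Set.mem_ofPred_eq]
    constructor
    · rintro ⟨w, hw⟩
      refine ⟨fun i => w (some i), w none, ?_⟩
      convert hw using 1
      ext ((_ | i) | i) <;> simp [consPoint]
    · rintro ⟨w, t, hw⟩
      refine ⟨consPoint t w, ?_⟩
      convert hw using 1
      ext ((_ | i) | i) <;> simp [consPoint]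

lemma IsSignDetermined.image [Finite σ] [Finite τ] {A : Set (σ → ℝ)} (hA : IsSignDetermined A)
    (P : τ → MvPolynomial σ ℝ) : IsSignDetermined ((fun x i => eval x (P i)) '' A) := by
  classical
  have := Fintype.ofFinite τ
  have h1 := ((hA.preimage (σ := σ ⊕ τ) fun i => X (Sum.inl i)).inter
    (isSignDetermined_zeros (Finset.univ.image fun i : τ =>
      rename Sum.inl (P i) - X (Sum.inr i)))).exists_sumElim
  convert h1 using 1
  ext z
  simp only [Set.mem_image, Set.mem_inter_iff, Set.mem_ofPred_eq, Finset.mem_image,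
    Finset.mem_univ, true_and, forall_exists_index, forall_apply_eq_imp_iff, eval_X,
    Sum.elim_inl, map_sub, Sum.elim_inr, eval_rename, Sum.elim_comp_inl, sub_eq_zero, funext_iff]

/-- Sign-determined subsets of `ℝ^m` are semialgebraic. -/
lemma IsSignDetermined.isSemialgebraic {m : ℕ} {A : Set (Fin m → ℝ)} (hA : IsSignDetermined A) :
    IsSemialgebraic A := by
  classical
  obtain ⟨F, hF⟩ := hA
  let sv : (Fin m → ℝ) → F → SignType := fun x f => SignType.sign (eval x (f : MvPolynomial _ ℝ))
  have hsv : ∀ x y, sv x = sv y → SameSigns F x y := fun x y h f hf => congrFun h ⟨f, hf⟩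
  let I := {ε : F → SignType // ∃ x ∈ A, sv x = ε}
  have : Fintype I := Fintype.ofFinite _
  refine ⟨Fintype.card I, fun i => {x | sv x = ((Fintype.equivFin I).symm i).1}, fun i => ?_, ?_⟩
  · beta_reduce
    generalize ((Fintype.equivFin I).symm i).1 = ε
    refine ⟨∑ f : F, if ε f = 0 then (f : MvPolynomial (Fin m) ℝ) ^ 2 else 0, Fintype.card F,
      fun j => if ε ((Fintype.equivFin F).symm j) = 0 then 1 else
        C ((ε ((Fintype.equivFin F).symm j) : ℤ) : ℝ) * ((Fintype.equivFin F).symm j).1, ?_⟩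
    ext x
    simp only [Set.mem_ofPred_eq, map_sum]
    rw [Finset.sum_eq_zero_iff_of_nonneg (fun f _ => by split_ifs <;> simp [sq_nonneg]),
      (Fintype.equivFin F).symm.forall_congr_left]
    simp only [Finset.mem_univ, true_implies, Equiv.symm_symm, Equiv.symm_apply_apply]
    rw [← forall_and, funext_iff]
    refine forall_congr' fun f => ?_
    simp only [sv]
    have hcases : ε f = 0 ∨ ε f = -1 ∨ ε f = 1 := by
      generalize ε f = s
      revert s
      decide
    rcases hcases with h | h | h
    · simp [h]
    · simp [h, sign_eq_neg_one_iff]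
    · simp [h, sign_eq_one_iff]
  · ext x
    simp only [Set.mem_iUnion, Set.mem_ofPred_eq]
    constructor
    · intro hx
      exact ⟨Fintype.equivFin I ⟨sv x, x, hx, rfl⟩, by simp⟩
    · rintro ⟨i, hi⟩
      obtain ⟨y, hy, hy'⟩ := ((Fintype.equivFin I).symm i).2
      exact hF y x (hsv _ _ (hy'.trans hi.symm)) hy

end SignSets

section Components

open Topology

/-- A set over a preconnected base is preconnected as soon as its fibres are and the
projection is open onto the base. -/
lemma isPreconnected_of_fibers {X Y : Type*} [TopologicalSpace X] [TopologicalSpace Y]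
    {π : X → Y} {D : Set X} {C : Set Y} (hC : IsPreconnected C) (hsurj : ∀ y ∈ C, ∃ x ∈ D, π x = y)
    (hfib : ∀ y ∈ C, IsPreconnected (D ∩ π ⁻¹' {y})) (hD : ∀ x ∈ D, π x ∈ C)
    (hopen : ∀ x ∈ D, ∀ u, IsOpen u → x ∈ u → π '' (D ∩ u) ∈ 𝓝[C] (π x)) :
    IsPreconnected D := by
  rintro u v hu hv huv ⟨a, ha, hau⟩ ⟨b, hb, hbv⟩
  have key : ∀ w, IsOpen w → ∀ x ∈ D, x ∈ w → π x ∈ interior (π '' (D ∩ w) ∪ Cᶜ) := by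
    intro w hw x hx hxw
    rw [mem_interior_iff_mem_nhds]
    filter_upwards [mem_nhdsWithin_iff_eventually.1 (hopen x hx w hw hxw)] with y hy
    by_cases h : y ∈ C
    · exact Or.inl (hy h)
    · exact Or.inr h
  obtain ⟨y, hy, hyu, hyv⟩ := hC _ _ isOpen_interior isOpen_interior
    (fun y hy => by
      obtain ⟨x, hx, rfl⟩ := hsurj y hy
      rcases huv hx with h | h
      · exact Or.inl (key u hu x hx h)
      · exact Or.inr (key v hv x hx h))
    ⟨π a, hD a ha, key u hu a ha hau⟩ ⟨π b, hD b hb, key v hv b hb hbv⟩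
  obtain ⟨p, ⟨hpD, hpu⟩, hp⟩ := (interior_subset hyu).resolve_right (not_not_intro hy)
  obtain ⟨q, ⟨hqD, hqv⟩, hq⟩ := (interior_subset hyv).resolve_right (not_not_intro hy)
  obtain ⟨x, hx, hxuv⟩ := hfib y hy u v hu hv (Set.inter_subset_left.trans huv)
    ⟨p, ⟨hpD, hp⟩, hpu⟩ ⟨q, ⟨hqD, hq⟩, hqv⟩
  exact ⟨x, hx.1, hxuv⟩

variable {σ : Type}

lemma continuous_consPoint : Continuous fun z : ℝ × (σ → ℝ) => consPoint z.1 z.2 := by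
  refine continuous_pi fun o => ?_
  cases o <;> simp only [consPoint, Option.elim] <;> fun_prop

/-- Away from the roots, sign vectors are locally constant in the parameters. -/
lemma signVector_eventually_eq_nhdsWithin {L : Finset (Polynomial (MvPolynomial σ ℝ))}
    {C : Set (σ → ℝ)} (hC : ∀ x ∈ C, ∀ y ∈ C, SameCoeffSigns L (eval x) (eval y))
    {x₁ : σ → ℝ} (hx₁ : x₁ ∈ C) {t : ℝ}
    (h : signVector L (eval x₁) t ∉ rootVectors L (eval x₁)) :
    ∀ᶠ x in 𝓝[C] x₁, signVector L (eval x) t = signVector L (eval x₁) t := by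
  simp only [signVector_eq_iff]
  rw [Filter.eventually_all_finset]
  intro f hf
  by_cases h0 : f.map (eval x₁) = 0
  · filter_upwards [self_mem_nhdsWithin] with x hx
    rw [signAt, signAt, h0, (hC x₁ hx₁ x hx).map_eq_zero_iff hf |>.1 h0]
  · have hc : ContinuousAt (fun x : σ → ℝ => (f.map (eval x)).eval t) x₁ := by
      simp only [← eval_optionEquivLeft_symm]
      exact ((MvPolynomial.continuous_eval _).comp
        (continuous_consPoint.comp (Continuous.prodMk_right t))).continuousAt
    refine Filter.Eventually.filter_mono nhdsWithin_le_nhds ?_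
    rcases lt_trichotomy ((f.map (eval x₁)).eval t) 0 with h1 | h1 | h1
    · filter_upwards [hc.eventually_lt_const h1] with x hx
      rw [signAt, signAt, sign_neg hx, sign_neg h1]
    · exact absurd ⟨⟨f, hf⟩, h0, by simp [signVector, signAt, h1]⟩ h
    · filter_upwards [hc.eventually_const_lt h1] with x hx
      rw [signAt, signAt, sign_pos hx, sign_pos h1]

lemma finite_setOf_mem_rootVectors {A : Type*} [CommRing A] (S : Finset (Polynomial A))
    (x : A →+* ℝ) : {t | signVector S x t ∈ rootVectors S x}.Finite := by
  refine (Set.finite_iUnion fun g : {g : S // (g : Polynomial A).map x ≠ 0} =>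
    (g.1.1.map x).roots.toFinset.finite_toSet).subset ?_
  rintro t ⟨g, hg, h0⟩
  refine Set.mem_iUnion.2 ⟨⟨g, hg⟩, ?_⟩
  simpa [hg] using sign_eq_zero_iff.1 h0

/-- Points realising a sign vector can be followed continuously in the parameters. -/
lemma IsElimClosed.eventually_exists_near {L : Finset (Polynomial (MvPolynomial σ ℝ))}
    (hL : IsElimClosed L) {C : Set (σ → ℝ)}
    (hC : ∀ x ∈ C, ∀ y ∈ C, SameCoeffSigns L (eval x) (eval y))
    {x₁ : σ → ℝ} (hx₁ : x₁ ∈ C) (t₁ : ℝ) {δ : ℝ} (hδ : 0 < δ) :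
    ∀ᶠ x in 𝓝[C] x₁, ∃ t, |t - t₁| < δ ∧
      signVector L (eval x) t = signVector L (eval x₁) t₁ := by
  by_cases h : signVector L (eval x₁) t₁ ∈ rootVectors L (eval x₁)
  swap
  · filter_upwards [signVector_eventually_eq_nhdsWithin hC hx₁ h] with x hx
    exact ⟨t₁, by simpa using hδ, hx⟩
  obtain ⟨a, ⟨ha1, ha2⟩, ha⟩ := ((Set.Ioo_infinite (sub_lt_self t₁ hδ)).sdiff
    (finite_setOf_mem_rootVectors L (eval x₁))).nonempty
  obtain ⟨b, ⟨hb1, hb2⟩, hb⟩ := ((Set.Ioo_infinite (lt_add_of_pos_right t₁ hδ)).sdiff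
    (finite_setOf_mem_rootVectors L (eval x₁))).nonempty
  simp only [Set.mem_ofPred_eq] at ha hb
  filter_upwards [signVector_eventually_eq_nhdsWithin hC hx₁ ha,
    signVector_eventually_eq_nhdsWithin hC hx₁ hb, self_mem_nhdsWithin] with x hxa hxb hx
  have hs := hC x₁ hx₁ x hx
  obtain ⟨s, t, hst, hs1, ht1⟩ := hL.convex_and_embed.2 _ _ hs a t₁ ha2.le
  obtain ⟨t', s', hst', ht2, hs2⟩ := hL.convex_and_embed.2 _ _ hs t₁ b hb1.le
  have hconv := hL.convex_and_embed.1 (eval x)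
  have htr : signVector L (eval x) t ∈ rootVectors L (eval x) := by
    rw [ht1, ← hs.rootVectors_eq]
    exact h
  obtain rfl : t = t' := hconv.eq_of_mem_rootVectors htr (ht1.trans ht2.symm)
  rw [← hs.rootVectors_eq] at htr
  refine ⟨t, ?_, ht1⟩
  have h1 : a < t := by
    by_contra! hle
    apply ha
    rw [← hs1, ← hconv s t a hst hle (hs1.trans hxa.symm)]
    exact htr
  have h2 : t < b := by
    by_contra! hle
    apply hb
    rw [← hxb, ← hconv b t s' hle hst' (hxb.trans hs2.symm)]
    exact htr
  rw [abs_lt]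
  constructor <;> linarith

/-- Every finite family of polynomials can be enlarged so that its sign cells are connected. -/
lemma exists_isPreconnected_sameSigns [Finite σ] (F : Finset (MvPolynomial σ ℝ)) :
    ∃ F', F ⊆ F' ∧ ∀ x₀, IsPreconnected {x | SameSigns F' x₀ x} := by
  classical
  suffices H : ∀ F : Finset (MvPolynomial σ ℝ),
    ∃ F', F ⊆ F' ∧ ∀ x₀, IsPreconnected {x | SameSigns F' x₀ x} from H F
  refine Finite.induction_empty_option (P := fun σ => ∀ F : Finset (MvPolynomial σ ℝ),
    ∃ F', F ⊆ F' ∧ ∀ x₀, IsPreconnected {x | SameSigns F' x₀ x}) ?_ ?_ ?_ σ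
  · intro α β e h F
    obtain ⟨F', hF, hF'⟩ := h (F.image (rename e.symm))
    refine ⟨F'.image (rename e), fun f hf => Finset.mem_image.2
      ⟨_, hF (Finset.mem_image_of_mem _ hf), by simp [rename_rename]⟩, fun x₀ => ?_⟩
    have hc : Continuous fun x : α → ℝ => x ∘ e.symm :=
      continuous_pi fun i => continuous_apply _
    convert (hF' (x₀ ∘ e)).image _ hc.continuousOn using 1
    ext x
    simp only [SameSigns, Finset.forall_mem_image, Set.mem_ofPred_eq, eval_rename, Set.mem_image]
    constructor
    · intro hx
      exact ⟨x ∘ e, fun f hf => hx hf, by ext; simp⟩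
    · rintro ⟨y, hy, rfl⟩ f hf
      rw [hy f hf]
      congr 3
      ext; simp
  · intro F
    exact ⟨F, subset_rfl, fun x₀ => Set.subsingleton_of_subsingleton.isPreconnected⟩
  · intro α _ h F
    obtain ⟨L, hFL, hL⟩ := exists_isElimClosed (F.image (optionEquivLeft ℝ α))
    obtain ⟨E, hLE, hE⟩ := h (allCoeffs L)
    refine ⟨L.image (optionEquivLeft ℝ α).symm ∪ E.image (rename some), fun f hf =>
      Finset.mem_union_left _ (Finset.mem_image.2 ⟨_, hFL (Finset.mem_image_of_mem _ hf),
        AlgEquiv.symm_apply_apply _ _⟩), fun z₀ => ?_⟩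
    have hcons : ∀ z : Option α → ℝ, z = consPoint (z none) (z ∘ some) := by
      intro z
      ext (_ | i) <;> rfl
    have hmem : ∀ (t : ℝ) (y : α → ℝ), SameSigns
        (L.image (optionEquivLeft ℝ α).symm ∪ E.image (rename some)) z₀ (consPoint t y) ↔
        signVector L (eval y) t = signVector L (eval (z₀ ∘ some)) (z₀ none) ∧
        SameSigns E (z₀ ∘ some) y := by
      intro t y
      simp only [SameSigns, Finset.mem_union, or_imp, forall_and, Finset.mem_image,
        forall_exists_index, and_imp, forall_apply_eq_imp_iff₂, eval_rename]
      nth_rw 1 [hcons z₀]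
      simp only [eval_optionEquivLeft_symm, signVector_eq_iff, signAt]
      exact and_congr (forall₂_congr fun _ _ => eq_comm) Iff.rfl
    have hC : ∀ x ∈ {x | SameSigns E (z₀ ∘ some) x}, ∀ y ∈ {x | SameSigns E (z₀ ∘ some) x},
        SameCoeffSigns L (eval x) (eval y) := fun x hx y hy =>
      sameCoeffSigns_of_sameSigns ((hx.symm.trans hy).mono hLE)
    have hz₀ : z₀ ∘ some ∈ {x | SameSigns E (z₀ ∘ some) x} := fun f _ => rfl
    refine isPreconnected_of_fibers (π := fun z => z ∘ some) (hE (z₀ ∘ some)) ?_ ?_ ?_ ?_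
    · intro y hy
      obtain ⟨t, -, -, ht, -⟩ := hL.convex_and_embed.2 _ _ (hC _ hz₀ y hy)
        (z₀ none) (z₀ none) le_rfl
      exact ⟨consPoint t y, (hmem t y).2 ⟨ht, hy⟩, rfl⟩
    · intro y hy
      have hord : Set.OrdConnected
          {t | signVector L (eval y) t = signVector L (eval (z₀ ∘ some)) (z₀ none)} :=
        ⟨fun s hs t ht u hu => (hL.convex_and_embed.1 (eval y) s u t hu.1 hu.2
          (hs.trans ht.symm)).trans hs⟩
      convert hord.isPreconnected.image (fun t => consPoint t y)
        (continuous_consPoint.comp (Continuous.prodMk_left y)).continuousOn using 1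
      ext z
      simp only [Set.mem_inter_iff, Set.mem_ofPred_eq, Set.mem_preimage, Set.mem_singleton_iff,
        Set.mem_image]
      constructor
      · rintro ⟨hz, rfl⟩
        rw [hcons z, hmem] at hz
        exact ⟨z none, hz.1, (hcons z).symm⟩
      · rintro ⟨t, ht, rfl⟩
        exact ⟨(hmem t y).2 ⟨ht, hy⟩, rfl⟩
    · intro z hz
      rw [Set.mem_ofPred_eq, hcons z, hmem] at hz
      exact hz.2
    · intro z hz u hu hzu
      rw [Set.mem_ofPred_eq, hcons z, hmem] at hz
      have hn : (fun w : ℝ × (α → ℝ) => consPoint w.1 w.2) ⁻¹' u ∈ 𝓝 (z none, z ∘ some) :=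
        continuous_consPoint.continuousAt.preimage_mem_nhds
          (hu.mem_nhds (by simpa only [← hcons] using hzu))
      obtain ⟨U, hU, V, hV, hUV⟩ := mem_nhds_prod_iff.1 hn
      obtain ⟨δ, hδ, hball⟩ := Metric.mem_nhds_iff.1 hU
      filter_upwards [hL.eventually_exists_near hC hz.2 (z none) hδ, mem_nhdsWithin_of_mem_nhds hV,
        self_mem_nhdsWithin] with y ⟨t, ht, hty⟩ hyV hyC
      exact ⟨consPoint t y, ⟨(hmem t y).2 ⟨hty.trans hz.1, hyC⟩,
        hUV (Set.mk_mem_prod (hball (by rwa [Metric.mem_ball, Real.dist_eq])) hyV)⟩, rfl⟩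

lemma IsSignDetermined.connectedComponentIn [Finite σ] {A : Set (σ → ℝ)} (hA : IsSignDetermined A)
    (x : σ → ℝ) : IsSignDetermined (connectedComponentIn A x) := by
  obtain ⟨F, hF⟩ := hA
  obtain ⟨F', hFF', hF'⟩ := exists_isPreconnected_sameSigns F
  refine ⟨F', fun y z hyz hy => ?_⟩
  rw [connectedComponentIn_eq hy]
  refine (hF' y).subset_connectedComponentIn (fun f _ => rfl) (fun w hw => ?_) hyz
  exact hF y w (SameSigns.mono hFF' hw) (connectedComponentIn_subset _ _ hy)

end Components

section Embedding

open Topology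

lemma exists_finset_zeros {σ : Type} [Finite σ] (T : Set (MvPolynomial σ ℝ)) :
    ∃ F : Finset (MvPolynomial σ ℝ), (F : Set (MvPolynomial σ ℝ)) ⊆ T ∧
      ∀ x, (∀ f ∈ F, eval x f = 0) → ∀ f ∈ T, eval x f = 0 := by
  obtain ⟨F, hF, hspan⟩ := (Submodule.fg_span_iff_fg_span_finset_subset T).1
    (IsNoetherian.noetherian (Ideal.span T))
  refine ⟨F, hF, fun x hx f hf => ?_⟩
  have h1 : Ideal.span (F : Set (MvPolynomial σ ℝ)) ≤ RingHom.ker (eval x) :=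
    Ideal.span_le.2 fun g hg => hx g hg
  have h2 : f ∈ Ideal.span (F : Set (MvPolynomial σ ℝ)) := by
    rw [Ideal.span, ← hspan]
    exact Submodule.subset_span hf
  exact h1 h2

variable {n : ℕ}

lemma continuous_entriesDet :
    Continuous (entriesDet : GL (Fin n) ℝ → (Fin n × Fin n) ⊕ Unit → ℝ) := by
  have hval : Continuous fun g : GL (Fin n) ℝ => (g : Matrix (Fin n) (Fin n) ℝ) :=
    Units.continuous_val
  refine continuous_pi fun i => ?_
  rcases i with p | _
  · exact hval.matrix_elem p.1 p.2
  · refine Continuous.inv₀ hval.matrix_det fun g => ?_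
    exact ((Matrix.isUnit_iff_isUnit_det _).1 g.isUnit).ne_zero

lemma isInducing_entriesDet :
    IsInducing (entriesDet : GL (Fin n) ℝ → (Fin n × Fin n) ⊕ Unit → ℝ) := by
  let A : ((Fin n × Fin n) ⊕ Unit → ℝ) → Matrix (Fin n) (Fin n) ℝ :=
    fun w => Matrix.of fun i j => w (Sum.inl (i, j))
  have hA : Continuous A := continuous_matrix fun i j => continuous_apply _
  refine IsInducing.of_comp (g := fun w => (A w, MulOpposite.op (w (Sum.inr ()) • (A w).adjugate)))
    continuous_entriesDet (hA.prodMk (MulOpposite.continuous_op.comp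
      ((continuous_apply _).smul hA.matrix_adjugate))) ?_
  convert (Units.isEmbedding_embedProduct (M := Matrix (Fin n) (Fin n) ℝ)).isInducing using 1
  ext1 g
  have hAg : A (entriesDet g) = g := rfl
  simp only [Function.comp_apply, Units.embedProduct_apply, hAg, Prod.mk.injEq, true_and]
  rw [Matrix.coe_units_inv, Matrix.inv_def, Ring.inverse_eq_inv']
  rfl

lemma injective_entriesDet :
    Function.Injective (entriesDet : GL (Fin n) ℝ → (Fin n × Fin n) ⊕ Unit → ℝ) := by
  intro g h hgh
  ext i j
  exact congrFun hgh (Sum.inl (i, j))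

/-- The equation `det(A) u = 1` cutting out `GL_n(ℝ)` in `ℝ^{n²+1}`. -/
noncomputable def detEquation (n : ℕ) : MvPolynomial ((Fin n × Fin n) ⊕ Unit) ℝ :=
  (Matrix.of fun i j => X (Sum.inl (i, j)) : Matrix (Fin n) (Fin n) _).det * X (Sum.inr ()) - 1

lemma eval_detEquation_eq_zero_iff {w : (Fin n × Fin n) ⊕ Unit → ℝ} :
    eval w (detEquation n) = 0 ↔ w ∈ Set.range (entriesDet (n := n)) := by
  have h : eval w (detEquation n) =
      (Matrix.of fun i j => w (Sum.inl (i, j)) : Matrix (Fin n) (Fin n) ℝ).det *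
        w (Sum.inr ()) - 1 := by
    rw [detEquation, map_sub, map_mul, map_one, eval_X, RingHom.map_det]
    congr 3
    ext i j
    simp
  rw [h, sub_eq_zero]
  constructor
  · intro hw
    have hdet : (Matrix.of fun i j => w (Sum.inl (i, j)) : Matrix (Fin n) (Fin n) ℝ).det ≠ 0 :=
      left_ne_zero_of_mul_eq_one hw
    refine ⟨Matrix.GeneralLinearGroup.mkOfDetNeZero _ hdet, ?_⟩
    ext (p | _)
    · rfl
    · exact inv_eq_of_mul_eq_one_right hw
  · rintro ⟨g, rfl⟩
    exact mul_inv_cancel₀ ((Matrix.isUnit_iff_isUnit_det _).1 g.isUnit).ne_zero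

lemma isClosed_range_entriesDet : IsClosed (Set.range (entriesDet (n := n))) := by
  have : Set.range (entriesDet (n := n)) = {w | eval w (detEquation n) = 0} := by
    ext w
    exact eval_detEquation_eq_zero_iff.symm
  rw [this]
  exact isClosed_eq (MvPolynomial.continuous_eval _) continuous_const

lemma IsZariskiClosedSubgroup.isClosed {G : Subgroup (GL (Fin n) ℝ)}
    (hG : IsZariskiClosedSubgroup G) : IsClosed (G : Set (GL (Fin n) ℝ)) := by
  obtain ⟨T, hT⟩ := hG
  have : (G : Set (GL (Fin n) ℝ)) = ⋂ P ∈ T, {g | eval (entriesDet g) P = 0} := by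
    ext g
    simp [hT]
  rw [this]
  exact isClosed_biInter fun P _ => isClosed_eq
    ((MvPolynomial.continuous_eval P).comp continuous_entriesDet) continuous_const

lemma IsZariskiClosedSubgroup.isSignDetermined {G : Subgroup (GL (Fin n) ℝ)}
    (hG : IsZariskiClosedSubgroup G) :
    IsSignDetermined (entriesDet '' (G : Set (GL (Fin n) ℝ))) := by
  classical
  obtain ⟨T, hT⟩ := hG
  obtain ⟨F, hFT, hF⟩ := exists_finset_zeros T
  convert isSignDetermined_zeros (insert (detEquation n) F) using 1
  ext w
  simp only [Set.mem_image, SetLike.mem_coe, hT, Set.mem_ofPred_eq, Finset.forall_mem_insert,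
    eval_detEquation_eq_zero_iff]
  constructor
  · rintro ⟨g, hg, rfl⟩
    exact ⟨⟨g, rfl⟩, fun f hf => hg f (hFT hf)⟩
  · rintro ⟨⟨g, rfl⟩, hg⟩
    exact ⟨g, hF _ hg, rfl⟩

lemma Topology.IsInducing.image_connectedComponentIn {X Y : Type*} [TopologicalSpace X]
    [TopologicalSpace Y] {f : X → Y} (hf : IsInducing f) {A : Set X} {x : X}
    (hx : x ∈ A) : f '' connectedComponentIn A x = connectedComponentIn (f '' A) (f x) := by
  apply subset_antisymm
  · exact (isPreconnected_connectedComponentIn.image f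
      hf.continuous.continuousOn).subset_connectedComponentIn
      ⟨x, mem_connectedComponentIn hx, rfl⟩ (Set.image_mono (connectedComponentIn_subset _ _))
  · intro y hy
    obtain ⟨a, ha, rfl⟩ := connectedComponentIn_subset _ _ hy
    have hsub : connectedComponentIn (f '' A) (f x) ⊆ f '' A := connectedComponentIn_subset _ _
    have himg : f '' (A ∩ f ⁻¹' connectedComponentIn (f '' A) (f x)) =
        connectedComponentIn (f '' A) (f x) := by
      rw [Set.image_inter_preimage, Set.inter_eq_right]
      exact hsub
    have hpre : IsPreconnected (A ∩ f ⁻¹' connectedComponentIn (f '' A) (f x)) := by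
      rw [← hf.isPreconnected_image, himg]
      exact isPreconnected_connectedComponentIn
    exact ⟨a, hpre.subset_connectedComponentIn
      ⟨hx, mem_connectedComponentIn (Set.mem_image_of_mem f hx)⟩ Set.inter_subset_left
      ⟨ha, hy⟩, rfl⟩

lemma IsClosed.connectedComponentIn {X : Type*} [TopologicalSpace X] {A : Set X} (hA : IsClosed A)
    (x : X) : IsClosed (connectedComponentIn A x) := by
  by_cases hx : x ∈ A
  · rw [connectedComponentIn_eq_image hx]
    exact hA.isClosedEmbedding_subtypeVal.isClosedMap _ isClosed_connectedComponent
  · rw [connectedComponentIn_eq_empty hx]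
    exact isClosed_empty

end Embedding

section Invariants

open Topology MeasureTheory

/-- Continuous functions on compact subsets of affine space are uniform limits of polynomials. -/
lemma exists_eval_near {σ : Type} {Q : Set (σ → ℝ)} (hQ : IsCompact Q) (h : C(σ → ℝ, ℝ)) {ε : ℝ}
    (hε : 0 < ε) : ∃ f : MvPolynomial σ ℝ, ∀ x ∈ Q, |eval x f - h x| < ε := by
  let coord : σ → C(σ → ℝ, ℝ) := fun i => ⟨fun x => x i, continuous_apply i⟩
  have hev : ∀ (f : MvPolynomial σ ℝ) (x : σ → ℝ), aeval coord f x = eval x f := by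
    intro f x
    induction f using MvPolynomial.induction_on with
    | C a => simp
    | add p q hp hq => simp [hp, hq]
    | mul_X p i hp => simp [hp, coord]
  have hsep : (aeval coord : MvPolynomial σ ℝ →ₐ[ℝ] C(σ → ℝ, ℝ)).range.SeparatesPoints := by
    intro x y hxy
    obtain ⟨i, hi⟩ := Function.ne_iff.1 hxy
    exact ⟨coord i, ⟨coord i, ⟨X i, by simp⟩, rfl⟩, hi⟩
  obtain ⟨_, ⟨f, rfl⟩, hf⟩ :=
    ContinuousMap.exists_mem_subalgebra_near_continuous_of_isCompact_of_separatesPoints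
      hsep h hQ hε
  refine ⟨f, fun x hx => ?_⟩
  rw [← hev, ← Real.norm_eq_abs]
  exact hf x hx

variable {σ K : Type} [TopologicalSpace K]

/-- Evaluation at a point, as a ring homomorphism on continuous functions. -/
def evalAt (k : K) : C(K, ℝ) →+* ℝ := (Pi.evalRingHom _ k).comp ContinuousMap.coeFnRingHom

@[simp]
lemma evalAt_apply (k : K) (a : C(K, ℝ)) : evalAt k a = a k := rfl

/-- The map `w ↦ k · w` whose coordinates are polynomials in `w` with coefficients depending
continuously on `k`. -/
noncomputable def polyAct (Y : σ → MvPolynomial σ C(K, ℝ)) (k : K) (w : σ → ℝ) : σ → ℝ :=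
  fun i => eval₂ (evalAt k) w (Y i)

lemma continuous_eval₂_evalAt (P : MvPolynomial σ C(K, ℝ)) :
    Continuous fun z : K × (σ → ℝ) => eval₂ (evalAt z.1) z.2 P := by
  induction P using MvPolynomial.induction_on with
  | C a =>
    simp only [eval₂_C, evalAt_apply]
    fun_prop
  | add p q hp hq =>
    simp only [eval₂_add]
    fun_prop
  | mul_X p i hp =>
    simp only [eval₂_mul, eval₂_X]
    fun_prop

lemma continuous_polyAct (Y : σ → MvPolynomial σ C(K, ℝ)) :
    Continuous fun z : K × (σ → ℝ) => polyAct Y z.1 z.2 :=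
  continuous_pi fun i => continuous_eval₂_evalAt (Y i)

lemma eval_polyAct (Y : σ → MvPolynomial σ C(K, ℝ)) (f : MvPolynomial σ ℝ) (k : K) (w : σ → ℝ) :
    eval (polyAct Y k w) f =
      eval₂ (evalAt k) w (eval₂ (C.comp (algebraMap ℝ C(K, ℝ))) Y f) := by
  induction f using MvPolynomial.induction_on with
  | C a => simp
  | add p q hp hq => simp only [map_add, eval₂_add, hp, hq]
  | mul_X p i hp => simp only [map_mul, eval₂_mul, hp, eval_X, eval₂_X, polyAct]

variable [CompactSpace K] [MeasurableSpace K] [BorelSpace K]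

lemma exists_eval_eq_integral (μ : Measure K) [IsFiniteMeasure μ] (P : MvPolynomial σ C(K, ℝ)) :
    ∃ f : MvPolynomial σ ℝ, ∀ w, eval w f = ∫ k, eval₂ (evalAt k) w P ∂μ := by
  have hinteg : ∀ (P : MvPolynomial σ C(K, ℝ)) (w : σ → ℝ),
      Integrable (fun k => eval₂ (evalAt k) w P) μ := fun P w =>
    ((continuous_eval₂_evalAt P).comp
      (Continuous.prodMk_left w)).integrable_of_hasCompactSupport
      (HasCompactSupport.of_compactSpace _)
  induction P using MvPolynomial.induction_on with
  | C a => exact ⟨C (∫ k, a k ∂μ), fun w => by simp only [eval_C, eval₂_C, evalAt_apply]⟩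
  | add p q hp hq =>
    obtain ⟨f, hf⟩ := hp
    obtain ⟨g, hg⟩ := hq
    refine ⟨f + g, fun w => ?_⟩
    simp only [map_add, hf, hg, eval₂_add]
    rw [integral_add (hinteg p w) (hinteg q w)]
  | mul_X p i hp =>
    obtain ⟨f, hf⟩ := hp
    refine ⟨f * X i, fun w => ?_⟩
    simp only [map_mul, hf, eval₂_mul, eval_X, eval₂_X]
    rw [integral_mul_const]

/-- Averages of polynomials along a polynomial action are polynomials. -/
lemma exists_eval_eq_integral_polyAct (μ : Measure K) [IsFiniteMeasure μ]
    (Y : σ → MvPolynomial σ C(K, ℝ)) (f : MvPolynomial σ ℝ) :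
    ∃ g : MvPolynomial σ ℝ, ∀ w, eval w g = ∫ k, eval (polyAct Y k w) f ∂μ := by
  simp only [eval_polyAct]
  exact exists_eval_eq_integral μ _

lemma integrable_eval_polyAct (μ : Measure K) [IsFiniteMeasure μ]
    (Y : σ → MvPolynomial σ C(K, ℝ)) (f : MvPolynomial σ ℝ) (w : σ → ℝ) :
    Integrable (fun k => eval (polyAct Y k w) f) μ :=
  ((MvPolynomial.continuous_eval f).comp ((continuous_polyAct Y).comp
    (Continuous.prodMk_left w))).integrable_of_hasCompactSupport
      (HasCompactSupport.of_compactSpace _)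

variable [Group K] [IsTopologicalGroup K]

/-- Distinct orbits of a compact group are separated by an invariant polynomial. -/
lemma exists_invariant_ne (μ : Measure K) [IsProbabilityMeasure μ] [μ.IsMulLeftInvariant]
    {Y : σ → MvPolynomial σ C(K, ℝ)} [Finite σ]
    (hmul : ∀ k k' w, polyAct Y (k * k') w = polyAct Y k' (polyAct Y k w))
    (hone : ∀ w, polyAct Y 1 w = w)
    {w w' : σ → ℝ} (hne : ∀ k, polyAct Y k w ≠ w') :
    ∃ f : MvPolynomial σ ℝ, (∀ k w, eval (polyAct Y k w) f = eval w f) ∧ eval w f ≠ eval w' f := by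
  have := Fintype.ofFinite σ
  have hcomp : ∀ w, IsCompact (Set.range fun k => polyAct Y k w) := fun w =>
    isCompact_range ((continuous_polyAct Y).comp (Continuous.prodMk_left w))
  have hdisj : Disjoint (Set.range fun k => polyAct Y k w) (Set.range fun k => polyAct Y k w') := by
    rw [Set.disjoint_left]
    rintro _ ⟨k, rfl⟩ ⟨k', hk⟩
    refine hne (k * k'⁻¹) ?_
    rw [hmul, ← show polyAct Y k' w' = polyAct Y k w from hk, ← hmul, mul_inv_cancel, hone]
  obtain ⟨h, h0, h1, -⟩ := exists_continuous_zero_one_of_isClosed (hcomp w).isClosed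
    (hcomp w').isClosed hdisj
  obtain ⟨f, hf⟩ := exists_eval_near ((hcomp w).union (hcomp w')) h (ε := 1 / 3) (by norm_num)
  obtain ⟨g, hg⟩ := exists_eval_eq_integral_polyAct μ Y f
  refine ⟨g, fun k w => ?_, ne_of_lt ?_⟩
  · simp only [hg, ← hmul]
    exact integral_mul_left_eq_self (fun k => eval (polyAct Y k w) f) k
  · have hlt : eval w g ≤ 1 / 3 := by
      rw [hg]
      have := integral_mono (integrable_eval_polyAct μ Y f w) (integrable_const (1 / 3 : ℝ))
        fun k => by
          have h2 := hf _ (Or.inl ⟨k, rfl⟩)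
          rw [h0 ⟨k, rfl⟩, abs_lt] at h2
          simpa using h2.2.le
      simpa using this
    have hgt : 2 / 3 ≤ eval w' g := by
      rw [hg]
      have := integral_mono (integrable_const (2 / 3 : ℝ)) (integrable_eval_polyAct μ Y f w')
        fun k => by
          have h2 := hf _ (Or.inr ⟨k, rfl⟩)
          rw [h1 ⟨k, rfl⟩, abs_lt, Pi.one_apply] at h2
          change (2 / 3 : ℝ) ≤ eval (polyAct Y k w') f
          linarith [h2.1]
      simpa using this
    linarith

/-- There is an invariant polynomial all of whose sublevel sets are bounded. -/
lemma exists_invariant_proper (μ : Measure K) [IsProbabilityMeasure μ] [μ.IsMulLeftInvariant]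
    {Y : σ → MvPolynomial σ C(K, ℝ)} [Finite σ]
    (hmul : ∀ k k' w, polyAct Y (k * k') w = polyAct Y k' (polyAct Y k w))
    (hone : ∀ w, polyAct Y 1 w = w) :
    ∃ f : MvPolynomial σ ℝ, (∀ k w, eval (polyAct Y k w) f = eval w f) ∧
      ∀ R, ∃ Q, IsCompact Q ∧ ∀ w, eval w f ≤ R → w ∈ Q := by
  have := Fintype.ofFinite σ
  obtain ⟨g, hg⟩ := exists_eval_eq_integral_polyAct μ Y (∑ i, X i ^ 2)
  refine ⟨g, fun k w => ?_, fun R => ?_⟩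
  · simp only [hg, ← hmul]
    exact integral_mul_left_eq_self (fun k => eval (polyAct Y k w) (∑ i, X i ^ 2)) k
  · refine ⟨(fun z : K × (σ → ℝ) => polyAct Y z.1 z.2) ''
      (Set.univ ×ˢ Set.univ.pi fun _ => Set.Icc (-(R + 1)) (R + 1)),
      (isCompact_univ.prod (isCompact_univ_pi fun _ => isCompact_Icc)).image
        (continuous_polyAct Y), fun w hw => ?_⟩
    obtain ⟨k, hk⟩ := exists_le_integral (integrable_eval_polyAct μ Y (∑ i, X i ^ 2) w)
    rw [← hg] at hk
    refine ⟨(k⁻¹, polyAct Y k w), ⟨Set.mem_univ _, fun i _ => ?_⟩, ?_⟩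
    · have h1 : polyAct Y k w i ^ 2 ≤ R := by
        refine le_trans ?_ (hk.trans hw)
        simp only [map_sum, map_pow, eval_X]
        exact Finset.single_le_sum (f := fun i => polyAct Y k w i ^ 2)
          (fun i _ => sq_nonneg _) (Finset.mem_univ i)
      constructor <;> nlinarith
    · change polyAct Y k⁻¹ (polyAct Y k w) = w
      rw [← hmul, mul_inv_cancel, hone]

/-- Finitely many invariant polynomials separate the orbits of a compact group acting
polynomially, and define a proper map. -/
lemma exists_separating_invariants {Y : σ → MvPolynomial σ C(K, ℝ)} [Finite σ]
    (hmul : ∀ k k' w, polyAct Y (k * k') w = polyAct Y k' (polyAct Y k w))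
    (hone : ∀ w, polyAct Y 1 w = w) :
    ∃ (d : ℕ) (P : Fin d → MvPolynomial σ ℝ), 1 ≤ d ∧
      (∀ w w', (∀ i, eval w (P i) = eval w' (P i)) ↔ ∃ k, polyAct Y k w = w') ∧
      IsProperMap fun w i => eval w (P i) := by
  classical
  let μ : Measure K := Measure.haarMeasure ⊤
  have : IsProbabilityMeasure μ := ⟨Measure.haarMeasure_self⟩
  obtain ⟨N, hN, hNR⟩ := exists_invariant_proper μ hmul hone
  let I : Set (MvPolynomial σ ℝ) := {f | ∀ k w, eval (polyAct Y k w) f = eval w f}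
  let D : MvPolynomial σ ℝ → MvPolynomial (σ ⊕ σ) ℝ := fun f => rename Sum.inl f - rename Sum.inr f
  have hD : ∀ f w w', eval (Sum.elim w w') (D f) = eval w f - eval w' f := fun f w w' => by
    simp [D, eval_rename]
  obtain ⟨F, hFI, hF⟩ := exists_finset_zeros (D '' I)
  obtain ⟨S, hSI, rfl⟩ := Finset.subset_set_image_iff.1 hFI
  let S' := insert N S
  have hS' : ∀ f ∈ S', ∀ k w, eval (polyAct Y k w) f = eval w f := by
    intro f hf
    rcases Finset.mem_insert.1 hf with rfl | hf
    · exact hN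
    · exact hSI hf
  refine ⟨S'.card, fun i => (S'.equivFin.symm i).1, Finset.card_pos.2
    ⟨N, Finset.mem_insert_self _ _⟩,
    fun w w' => ⟨fun h => ?_, ?_⟩, ?_⟩
  · by_contra! hne
    obtain ⟨f, hf, hfne⟩ := exists_invariant_ne μ hmul hone hne
    refine sub_ne_zero.2 hfne ?_
    rw [← hD]
    refine hF _ (fun g hg => ?_) _ ⟨f, hf, rfl⟩
    obtain ⟨s, hs, rfl⟩ := Finset.mem_image.1 hg
    rw [hD, sub_eq_zero]
    simpa using h (S'.equivFin ⟨s, Finset.mem_insert_of_mem hs⟩)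
  · rintro ⟨k, rfl⟩ i
    exact (hS' _ (S'.equivFin.symm i).2 k w).symm
  · rw [isProperMap_iff_isCompact_preimage]
    have hc : Continuous fun (w : σ → ℝ) (i : Fin S'.card) => eval w (S'.equivFin.symm i).1 :=
      continuous_pi fun i => MvPolynomial.continuous_eval _
    refine ⟨hc, fun B hB => ?_⟩
    let i₀ := S'.equivFin ⟨N, Finset.mem_insert_self _ _⟩
    obtain ⟨R, hR⟩ := (hB.image (continuous_apply i₀)).bddAbove
    obtain ⟨Q, hQ, hQw⟩ := hNR R
    refine hQ.of_isClosed_subset (hB.isClosed.preimage hc) fun w hw => hQw w ?_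
    have := hR (Set.mem_image_of_mem _ hw)
    simpa [i₀] using this

end Invariants

section Quotient

open Topology

variable {n : ℕ}

/-- Right multiplication by elements of `M ⊆ GL_n(ℝ)`, as a family of polynomial maps on
`ℝ^{n²+1}`. -/
noncomputable def rightMulPoly (M : Subgroup (GL (Fin n) ℝ)) :
    (Fin n × Fin n) ⊕ Unit → MvPolynomial ((Fin n × Fin n) ⊕ Unit) C(M, ℝ) :=
  have hc : Continuous fun m : M => entriesDet (m : GL (Fin n) ℝ) :=
    continuous_entriesDet.comp continuous_subtype_val
  Sum.elim
    (fun p => ∑ l, X (Sum.inl (p.1, l)) * C ⟨fun m => entriesDet m.1 (Sum.inl (l, p.2)),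
      (continuous_apply _).comp hc⟩)
    (fun _ => X (Sum.inr ()) * C ⟨fun m => entriesDet m.1 (Sum.inr ()),
      (continuous_apply _).comp hc⟩)

lemma polyAct_rightMulPoly_inl (M : Subgroup (GL (Fin n) ℝ)) (m : M)
    (w : (Fin n × Fin n) ⊕ Unit → ℝ) (i j : Fin n) :
    polyAct (rightMulPoly M) m w (Sum.inl (i, j)) =
      ∑ l, w (Sum.inl (i, l)) * (m.1 : Matrix (Fin n) (Fin n) ℝ) l j := by
  simp [polyAct, rightMulPoly, eval₂_sum, entriesDet]

lemma polyAct_rightMulPoly_inr (M : Subgroup (GL (Fin n) ℝ)) (m : M)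
    (w : (Fin n × Fin n) ⊕ Unit → ℝ) :
    polyAct (rightMulPoly M) m w (Sum.inr ()) =
      w (Sum.inr ()) * (m.1 : Matrix (Fin n) (Fin n) ℝ).det⁻¹ := by
  simp [polyAct, rightMulPoly, entriesDet]

lemma polyAct_rightMulPoly_one (M : Subgroup (GL (Fin n) ℝ)) (w : (Fin n × Fin n) ⊕ Unit → ℝ) :
    polyAct (rightMulPoly M) 1 w = w := by
  ext (⟨i, j⟩ | ⟨⟩)
  · rw [polyAct_rightMulPoly_inl]
    simp [Matrix.one_apply]
  · rw [polyAct_rightMulPoly_inr]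
    simp

lemma polyAct_rightMulPoly_mul (M : Subgroup (GL (Fin n) ℝ)) (m m' : M)
    (w : (Fin n × Fin n) ⊕ Unit → ℝ) :
    polyAct (rightMulPoly M) (m * m') w =
      polyAct (rightMulPoly M) m' (polyAct (rightMulPoly M) m w) := by
  ext (⟨i, j⟩ | ⟨⟩)
  · simp only [polyAct_rightMulPoly_inl, Subgroup.coe_mul, Units.val_mul, Matrix.mul_apply,
      Finset.mul_sum, Finset.sum_mul]
    rw [Finset.sum_comm]
    simp only [mul_assoc]
  · rw [polyAct_rightMulPoly_inr, polyAct_rightMulPoly_inr, polyAct_rightMulPoly_inr]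
    simp only [Subgroup.coe_mul, Units.val_mul, Matrix.det_mul, mul_inv,
      mul_assoc]

lemma polyAct_rightMulPoly_entriesDet (M : Subgroup (GL (Fin n) ℝ)) (m : M) (g : GL (Fin n) ℝ) :
    polyAct (rightMulPoly M) m (entriesDet g) = entriesDet (g * m.1) := by
  ext (⟨i, j⟩ | ⟨⟩)
  · rw [polyAct_rightMulPoly_inl]
    simp [entriesDet, Matrix.mul_apply]
  · rw [polyAct_rightMulPoly_inr]
    simp [entriesDet, mul_comm]

/-- A compact subgroup of `GL_n(ℝ)` has a finite family of regular functions which separates its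
left cosets and defines a closed map. -/
lemma exists_regular_separating (M : Subgroup (GL (Fin n) ℝ))
    (hM : IsCompact (M : Set (GL (Fin n) ℝ))) :
    ∃ (d : ℕ) (P : Fin d → MvPolynomial ((Fin n × Fin n) ⊕ Unit) ℝ), 1 ≤ d ∧
      (∀ g g' : GL (Fin n) ℝ, (fun i => eval (entriesDet g) (P i)) =
        (fun i => eval (entriesDet g') (P i)) ↔ g⁻¹ * g' ∈ M) ∧
      IsClosedMap fun (g : GL (Fin n) ℝ) i => eval (entriesDet g) (P i) := by
  have : CompactSpace M := isCompact_iff_compactSpace.1 hM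
  let _ : MeasurableSpace M := borel M
  have : BorelSpace M := ⟨rfl⟩
  obtain ⟨d, P, hd, hP, hproper⟩ := exists_separating_invariants (Y := rightMulPoly M)
    (polyAct_rightMulPoly_mul M) (polyAct_rightMulPoly_one M)
  refine ⟨d, P, hd, fun g g' => ?_, ?_⟩
  · rw [funext_iff, hP]
    simp only [polyAct_rightMulPoly_entriesDet, injective_entriesDet.eq_iff]
    constructor
    · rintro ⟨m, rfl⟩
      simp
    · intro h
      exact ⟨⟨_, h⟩, by simp⟩
  · have hι : IsClosedEmbedding (entriesDet : GL (Fin n) ℝ → (Fin n × Fin n) ⊕ Unit → ℝ) :=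
      ⟨⟨isInducing_entriesDet, injective_entriesDet⟩, isClosed_range_entriesDet⟩
    exact hproper.isClosedMap.comp hι.isClosedMap

/-- A continuous closed map identifies the quotient of a closed set by its fibres with the image. -/
lemma exists_homeomorph_quot_image {X Y : Type*} [TopologicalSpace X] [TopologicalSpace Y]
    {A : Set X} (hA : IsClosed A) {p : X → Y} (hp : Continuous p) (hpc : IsClosedMap p)
    (r : A → A → Prop) (hr : ∀ a b : A, p a = p b ↔ r a b) :
    ∃ φ : Quot r ≃ₜ (p '' A : Set Y), ∀ a : A, (φ (Quot.mk _ a) : Y) = p a := by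
  let q : A → (p '' A : Set Y) := fun a => ⟨p a, a, a.2, rfl⟩
  have hq : Continuous q := by fun_prop
  let φ : Quot r → (p '' A : Set Y) := Quot.lift q fun a b h => Subtype.ext ((hr a b).2 h)
  have hφ : IsHomeomorph φ := by
    rw [isHomeomorph_iff_continuous_isClosedMap_bijective]
    refine ⟨continuous_quot_lift _ hq, fun s hs => ?_, ?_, ?_⟩
    · have h1 : IsClosed (p '' (Subtype.val '' (Quot.mk r ⁻¹' s))) :=
        hpc _ (hA.isClosedEmbedding_subtypeVal.isClosedMap _ (hs.preimage continuous_quot_mk))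
      convert h1.preimage (continuous_subtype_val (p := (· ∈ p '' A))) using 1
      ext ⟨y, hy⟩
      constructor
      · rintro ⟨⟨a⟩, ha, hay⟩
        exact ⟨a, ⟨a, ha, rfl⟩, congrArg Subtype.val hay⟩
      · rintro ⟨_, ⟨a, ha, rfl⟩, hay⟩
        exact ⟨Quot.mk r a, ha, Subtype.ext hay⟩
    · rintro ⟨a⟩ ⟨b⟩ hab
      exact Quot.sound ((hr a b).1 (congrArg Subtype.val hab))
    · rintro ⟨_, a, ha, rfl⟩
      exact ⟨Quot.mk r ⟨a, ha⟩, rfl⟩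
  exact ⟨hφ.homeomorph φ, fun a => rfl⟩

lemma image_mul_left_eq_iff {H : Type*} [Group H] (M : Subgroup H) (g g' : H) :
    (fun x => g * x) '' (M : Set H) = (fun x => g' * x) '' (M : Set H) ↔ g⁻¹ * g' ∈ M :=
  leftCoset_eq_iff M

end Quotient

/-- For a Zariski-closed subgroup `G ⊆ GL_n(ℝ)` with euclidean identity component `G⁺`
and a compact connected subgroup `M ⊆ G⁺`, there is a regular map `p : GL_n(ℝ) → ℝ^d`
inducing a homeomorphism of `G⁺/M` (quotient topology) onto the semialgebraic set
`p(G⁺)` (euclidean topology), where `p(g) = p(g')` iff `gM = g'M` for `g, g' ∈ G⁺`. -/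
theorem quotient_by_compact_is_semialgebraic {n : ℕ}
    (G : Subgroup (GL (Fin n) ℝ)) (hG : IsZariskiClosedSubgroup G)
    (Gplus : Set (GL (Fin n) ℝ))
    (hGplus : Gplus = connectedComponentIn (G : Set (GL (Fin n) ℝ)) 1)
    (M : Subgroup (GL (Fin n) ℝ)) (hMsub : (M : Set (GL (Fin n) ℝ)) ⊆ Gplus)
    (hMcomp : IsCompact (M : Set (GL (Fin n) ℝ)))
    (hMconn : IsConnected (M : Set (GL (Fin n) ℝ))) :
    ∃ (d : ℕ), 1 ≤ d ∧ ∃ p : GL (Fin n) ℝ → (Fin d → ℝ), IsRegularMap p ∧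
      -- (i) p separates exactly the left cosets of M in G⁺
      (∀ g ∈ Gplus, ∀ g' ∈ Gplus,
        (p g = p g' ↔
          (fun x => g * x) '' (M : Set (GL (Fin n) ℝ)) =
            (fun x => g' * x) '' (M : Set (GL (Fin n) ℝ)))) ∧
      -- (ii) the image p(G⁺) is semialgebraic
      IsSemialgebraic (p '' Gplus) ∧
      -- (iii) the induced bijection from G⁺/M onto p(G⁺) is a homeomorphism
      ∃ φ : Quot (fun g g' : Gplus => (g : GL (Fin n) ℝ)⁻¹ * (g' : GL (Fin n) ℝ) ∈ M) ≃ₜ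
          (p '' Gplus : Set (Fin d → ℝ)),
        ∀ g : Gplus,
          (φ (Quot.mk _ g) : Fin d → ℝ) = p (g : GL (Fin n) ℝ) := by
  have hGc : IsClosed Gplus := hGplus ▸ hG.isClosed.connectedComponentIn 1
  obtain ⟨d, P, hd, hP, hclosed⟩ := exists_regular_separating M hMcomp
  have hcont : Continuous fun (g : GL (Fin n) ℝ) i => eval (entriesDet g) (P i) :=
    continuous_pi fun i => (MvPolynomial.continuous_eval (P i)).comp continuous_entriesDet
  refine ⟨d, hd, fun g i => eval (entriesDet g) (P i), ⟨P, fun g i => rfl⟩, fun g _ g' _ => ?_, ?_,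
    exists_homeomorph_quot_image hGc hcont hclosed _ fun g g' => hP g g'⟩
  · rw [hP, image_mul_left_eq_iff]
  · have h : IsSignDetermined (entriesDet '' Gplus) := by
      rw [hGplus, isInducing_entriesDet.image_connectedComponentIn G.one_mem]
      exact hG.isSignDetermined.connectedComponentIn _
    have h' := (h.image P).isSemialgebraic
    rwa [Set.image_image] at h'
end

section
/- Let M be a compact subgroup of GL_n(ℝ). Consider the action of M on the polynomial ring ℝ[x_1, …, x_n] given by (m · f)(x) = f(m⁻¹ x). Then the subalgebra ℝ[x_1, …, x_n]^M of M-invariant polynomials is a finitely generated ℝ-algebra. -/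
open Matrix MvPolynomial

/-- A polynomial `f ∈ ℝ[x_1, …, x_n]` is `M`-invariant for a subgroup `M ⊆ GL_n(ℝ)` if
`f(m · x) = f(x)` for every `m ∈ M` and every `x ∈ ℝ^n`; this is equivalent to invariance
under the action `(m · f)(x) = f(m⁻¹ x)`. -/
def IsInvariantPoly {n : ℕ} (M : Subgroup (GL (Fin n) ℝ)) (f : MvPolynomial (Fin n) ℝ) :
    Prop :=
  ∀ m ∈ M, ∀ x : Fin n → ℝ,
    eval ((m : Matrix (Fin n) (Fin n) ℝ).mulVec x) f = eval x f

namespace MvPolynomial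

section Hilbert

variable {σ K : Type*} [Field K]

theorem homogeneousComponent_mul_of_isHomogeneous_right {f g : MvPolynomial σ K} {d : ℕ}
    (hg : g.IsHomogeneous d) (n : ℕ) :
    homogeneousComponent (n + d) (f * g) = homogeneousComponent n f * g := by
  conv_lhs => rw [← sum_homogeneousComponent f, Finset.sum_mul, map_sum]
  have key (i : ℕ) : homogeneousComponent (n + d) (homogeneousComponent i f * g) =
      if i = n then homogeneousComponent n f * g else 0 := by
    rw [homogeneousComponent_of_mem ((homogeneousComponent_isHomogeneous i f).mul hg)]
    by_cases h : i = n
    · simp [h]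
    · rw [if_neg (by omega), if_neg h]
  simp_rw [key]
  rw [Finset.sum_ite_eq']
  split_ifs with h
  · rfl
  · rw [homogeneousComponent_eq_zero _ _ (by simpa using h), zero_mul]

theorem homogeneousComponent_mul_of_isHomogeneous_right_of_lt {f g : MvPolynomial σ K} {d n : ℕ}
    (hg : g.IsHomogeneous d) (h : n < d) :
    homogeneousComponent n (f * g) = 0 := by
  conv_lhs => rw [← sum_homogeneousComponent f, Finset.sum_mul, map_sum]
  refine Finset.sum_eq_zero fun i _ => ?_
  rw [homogeneousComponent_of_mem ((homogeneousComponent_isHomogeneous i f).mul hg),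
    if_neg (by omega)]

/-- **Hilbert's finiteness theorem**: a graded subalgebra of a polynomial ring which is a retract,
as a module over itself, is finitely generated. -/
theorem fg_of_graded_of_retraction [Finite σ] (A : Subalgebra K (MvPolynomial σ K))
    (hA : ∀ f ∈ A, ∀ d, homogeneousComponent d f ∈ A)
    (R : MvPolynomial σ K →ₗ[A] A) (hR : R 1 = 1) : A.FG := by
  classical
  let S : Set (MvPolynomial σ K) := {f | f ∈ A ∧ ∃ d, 0 < d ∧ f.IsHomogeneous d}
  obtain ⟨t, htS, ht⟩ := (Submodule.fg_span_iff_fg_span_finset_subset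
    (R := MvPolynomial σ K) S).1 (IsNoetherian.noetherian _)
  have hRA (f : A) : R (f : MvPolynomial σ K) = f := by
    have := R.map_smul f 1
    rwa [hR, smul_eq_mul, mul_one, Subalgebra.smul_def, smul_eq_mul, mul_one] at this
  have homog (d : ℕ) : ∀ f ∈ A, f.IsHomogeneous d → f ∈ Algebra.adjoin K (t : Set _) := by
    induction d using Nat.strong_induction_on with
    | _ d ih =>
      intro f hf hfd
      rcases Nat.eq_zero_or_pos d with rfl | hd
      · rw [totalDegree_eq_zero_iff_eq_C.1 (Nat.le_zero.1 hfd.totalDegree_le)]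
        exact Subalgebra.algebraMap_mem _ _
      have hft : f ∈ Submodule.span (MvPolynomial σ K) (t : Set _) := by
        rw [← ht]
        exact Submodule.subset_span ⟨hf, d, hd, hfd⟩
      obtain ⟨c, -, hc⟩ := Submodule.mem_span_finset.1 hft
      have hfR : f = ∑ g ∈ t, (R (c g) : MvPolynomial σ K) * g := by
        have h1 := congrArg (Subtype.val ∘ R) hc
        simp only [Function.comp_apply, hRA ⟨f, hf⟩, map_sum, AddSubmonoidClass.coe_finsetSum] at h1
        rw [← h1]
        refine Finset.sum_congr rfl fun g hg => ?_
        have h2 := R.map_smul (⟨g, (htS hg).1⟩ : A) (c g)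
        rw [Subalgebra.smul_def, smul_eq_mul, mul_comm] at h2
        rw [smul_eq_mul, h2, smul_eq_mul, mul_comm]
        rfl
      rw [← homogeneousComponent_eq_self hfd, hfR, map_sum]
      refine Subalgebra.sum_mem _ fun g hg => ?_
      obtain ⟨hgA, e, he, hge⟩ := htS hg
      rcases lt_or_ge d e with hde | hde
      · rw [homogeneousComponent_mul_of_isHomogeneous_right_of_lt hge hde]
        exact Subalgebra.zero_mem _
      · obtain ⟨k, rfl⟩ := Nat.exists_eq_add_of_le' hde
        rw [homogeneousComponent_mul_of_isHomogeneous_right hge]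
        exact Subalgebra.mul_mem _
          (ih k (by omega) _ (hA _ (R (c g)).2 k) (homogeneousComponent_isHomogeneous _ _))
          (Algebra.subset_adjoin hg)
  refine ⟨t, le_antisymm (Algebra.adjoin_le fun g hg => (htS hg).1) fun f hf => ?_⟩
  rw [← sum_homogeneousComponent f]
  exact Subalgebra.sum_mem _ fun d _ =>
    homog d _ (hA f hf d) (homogeneousComponent_isHomogeneous _ _)

end Hilbert

section Average

/-- The evaluation at a point, as a ring homomorphism on continuous functions. -/
def continuousEval {G : Type*} [TopologicalSpace G] (g : G) : C(G, ℝ) →+* ℝ :=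
  (Pi.evalRingHom (fun _ : G => ℝ) g).comp ContinuousMap.coeFnRingHom

@[simp]
theorem continuousEval_apply {G : Type*} [TopologicalSpace G] (g : G) (c : C(G, ℝ)) :
    continuousEval g c = c g := rfl

open MeasureTheory

variable {σ G : Type*} [TopologicalSpace G] [CompactSpace G] [MeasurableSpace G] [BorelSpace G]
  (μ : Measure G) [IsFiniteMeasure μ]

theorem exists_eval_eq_integral_eval₂ (Q : MvPolynomial σ C(G, ℝ)) :
    ∃ r : MvPolynomial σ ℝ, ∀ x,
      Integrable (fun g => eval₂ (continuousEval g) x Q) μ ∧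
      eval x r = ∫ g, eval₂ (continuousEval g) x Q ∂μ := by
  induction Q using MvPolynomial.induction_on' with
  | monomial d c =>
    refine ⟨monomial d (∫ g, c g ∂μ), fun x => ?_⟩
    simp only [eval₂_monomial, eval_monomial, continuousEval_apply]
    refine ⟨Integrable.mul_const ?_ _, (integral_mul_const _ _).symm⟩
    exact c.continuous.integrable_of_hasCompactSupport (HasCompactSupport.of_compactSpace _)
  | add P Q hP hQ =>
    obtain ⟨r, hr⟩ := hP
    obtain ⟨s, hs⟩ := hQ
    refine ⟨r + s, fun x => ?_⟩
    simp only [eval₂_add, map_add]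
    exact ⟨(hr x).1.add (hs x).1, by rw [(hr x).2, (hs x).2, integral_add (hr x).1 (hs x).1]⟩

/-- Averaging a polynomial over a compact family of matrices gives a polynomial. -/
theorem exists_eval_eq_integral_mulVec {n : Type*} [Fintype n] {φ : G → Matrix n n ℝ}
    (hφ : Continuous φ) (p : MvPolynomial n ℝ) :
    ∃ r : MvPolynomial n ℝ, ∀ x,
      Integrable (fun g => eval (φ g *ᵥ x) p) μ ∧ eval x r = ∫ g, eval (φ g *ᵥ x) p ∂μ := by
  obtain ⟨r, hr⟩ := exists_eval_eq_integral_eval₂ μ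
    (eval₂ (C.comp (algebraMap ℝ C(G, ℝ)))
      (fun i => ∑ j, C (⟨fun g => φ g i j, hφ.matrix_elem i j⟩ : C(G, ℝ)) * X j) p)
  refine ⟨r, fun x => ?_⟩
  have key (g : G) : eval₂ (continuousEval g) x
      (eval₂ (C.comp (algebraMap ℝ C(G, ℝ)))
        (fun i => ∑ j, C (⟨fun g => φ g i j, hφ.matrix_elem i j⟩ : C(G, ℝ)) * X j) p) =
      eval (φ g *ᵥ x) p := by
    clear hr
    induction p using MvPolynomial.induction_on with
    | C a => simp
    | add p q hp hq => simp only [eval₂_add, map_add, hp, hq]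
    | mul_X p i hp =>
      simp only [eval₂_mul, eval₂_X, map_mul, hp, eval_X]
      simp [Matrix.mulVec, dotProduct, eval₂_sum]
  simpa only [key] using hr x

end Average

end MvPolynomial

/-- The subalgebra of `M`-invariant polynomials. -/
def invariantSubalgebra {n : ℕ} (M : Subgroup (GL (Fin n) ℝ)) :
    Subalgebra ℝ (MvPolynomial (Fin n) ℝ) where
  carrier := {f | IsInvariantPoly M f}
  mul_mem' hf hg m hm x := by rw [map_mul, map_mul, hf m hm, hg m hm]
  add_mem' hf hg m hm x := by rw [map_add, map_add, hf m hm, hg m hm]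
  algebraMap_mem' r m hm x := by simp [MvPolynomial.algebraMap_eq]

theorem IsInvariantPoly.homogeneousComponent {n : ℕ} {M : Subgroup (GL (Fin n) ℝ)}
    {f : MvPolynomial (Fin n) ℝ} (hf : IsInvariantPoly M f) (d : ℕ) :
    IsInvariantPoly M (homogeneousComponent d f) := by
  intro m hm x
  let L : MvPolynomial (Fin n) ℝ →ₐ[ℝ] MvPolynomial (Fin n) ℝ :=
    aeval fun i => ∑ j, C (m i j) * X j
  have hL (p : MvPolynomial (Fin n) ℝ) (y : Fin n → ℝ) :
      eval y (L p) = eval ((m : Matrix (Fin n) (Fin n) ℝ).mulVec y) p := by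
    induction p using MvPolynomial.induction_on with
    | C a => simp [L]
    | add p q hp hq => simp only [map_add, hp, hq]
    | mul_X p i hp =>
      rw [map_mul, map_mul, hp]
      simp [L, Matrix.mulVec, dotProduct]
  have hhom (k : ℕ) : (L (MvPolynomial.homogeneousComponent k f)).IsHomogeneous k := by
    have := (homogeneousComponent_isHomogeneous k f).aeval (n := 1)
      (fun i => ∑ j, C (m i j) * X j)
      (fun i => IsHomogeneous.sum _ _ _ fun j _ => isHomogeneous_C_mul_X _ _)
    rwa [one_mul] at this
  have hLf : L f = f := MvPolynomial.funext fun y => by rw [hL, hf m hm]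
  have hcomp : MvPolynomial.homogeneousComponent d (L f) =
      L (MvPolynomial.homogeneousComponent d f) := by
    conv_lhs => rw [← sum_homogeneousComponent f, map_sum, map_sum]
    simp_rw [fun k => homogeneousComponent_of_mem (m := d) (hhom k)]
    rw [Finset.sum_ite_eq]
    split_ifs with h
    · rfl
    · rw [homogeneousComponent_eq_zero _ _ (by simpa using h), map_zero]
  rw [← hL, ← hcomp, hLf]

open MeasureTheory in
/-- The Reynolds operator of a compact group, given by averaging over Haar measure. -/
theorem exists_reynolds {n : ℕ} (M : Subgroup (GL (Fin n) ℝ))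
    (hM : IsCompact (M : Set (GL (Fin n) ℝ))) :
    ∃ R : MvPolynomial (Fin n) ℝ →ₗ[invariantSubalgebra M] invariantSubalgebra M, R 1 = 1 := by
  have : CompactSpace M := isCompact_iff_compactSpace.1 hM
  let _ : MeasurableSpace M := borel M
  have : BorelSpace M := ⟨rfl⟩
  let μ : Measure M := Measure.haarMeasure ⊤
  have : IsProbabilityMeasure μ :=
    ⟨Measure.haarMeasure_self (K₀ := (⊤ : TopologicalSpace.PositiveCompacts M))⟩
  let φ : M → Matrix (Fin n) (Fin n) ℝ := fun m => ((m⁻¹ : M) : GL (Fin n) ℝ).1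
  have hφ : Continuous φ :=
    Units.continuous_val.comp (continuous_subtype_val.comp continuous_inv)
  choose r hr using exists_eval_eq_integral_mulVec μ hφ
  have hinv (p : MvPolynomial (Fin n) ℝ) : IsInvariantPoly M (r p) := by
    intro m hm x
    rw [(hr p _).2, (hr p _).2, ← integral_mul_left_eq_self _ (⟨m, hm⟩ : M)]
    refine integral_congr_ae (Filter.Eventually.of_forall fun g => ?_)
    have hφg : φ (⟨m, hm⟩ * g) * (m : Matrix (Fin n) (Fin n) ℝ) = φ g := by
      simp only [φ, ← Units.val_mul]
      simp
    simp only [Matrix.mulVec_mulVec, hφg]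
  refine ⟨{ toFun := fun p => ⟨r p, hinv p⟩, map_add' := fun p q => ?_, map_smul' := fun f p => ?_ },
    ?_⟩
  · refine Subtype.ext (MvPolynomial.funext fun x => ?_)
    change eval x (r (p + q)) = eval x (r p + r q)
    simp only [map_add, (hr _ x).2]
    exact integral_add (hr p x).1 (hr q x).1
  · refine Subtype.ext (MvPolynomial.funext fun x => ?_)
    have hf (g : M) : eval (φ g *ᵥ x) (f : MvPolynomial (Fin n) ℝ) = eval x f.1 :=
      f.2 _ (g⁻¹).2 x
    simp only [Subalgebra.smul_def, RingHom.id_apply, smul_eq_mul, MulMemClass.coe_mul, map_mul,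
      (hr _ x).2, hf]
    exact integral_const_mul _ _
  · refine Subtype.ext (MvPolynomial.funext fun x => ?_)
    simp [(hr _ x).2]

/-- Hilbert's finiteness theorem: for a compact subgroup `M ⊆ GL_n(ℝ)`, the algebra of
`M`-invariant polynomials is a finitely generated ℝ-algebra: it is generated, as an
ℝ-algebra, by finitely many invariant polynomials. -/
theorem invariants_finitely_generated {n : ℕ} (M : Subgroup (GL (Fin n) ℝ))
    (hM : IsCompact (M : Set (GL (Fin n) ℝ))) :
    ∃ s : Finset (MvPolynomial (Fin n) ℝ),
      {f | IsInvariantPoly M f} =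
        (Algebra.adjoin ℝ (s : Set (MvPolynomial (Fin n) ℝ)) :
          Subalgebra ℝ (MvPolynomial (Fin n) ℝ)) := by
  obtain ⟨R, hR⟩ := exists_reynolds M hM
  obtain ⟨s, hs⟩ := fg_of_graded_of_retraction (invariantSubalgebra M)
    (fun f hf d => IsInvariantPoly.homogeneousComponent hf d) R hR
  exact ⟨s, by rw [hs]; rfl⟩
end

section
/- Let M be a compact subgroup of GL_n(ℝ) and let x, y ∈ ℝ^n be such that y does not belong to the orbit M·x = {m · x : m ∈ M}. Then there exists an M-invariant polynomial f ∈ ℝ[x_1, …, x_n] with f(x) ≠ f(y). -/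
open Matrix MvPolynomial

open MeasureTheory

/-- Integrating a polynomial whose coefficients are continuous functions on a compact space,
coefficient by coefficient, gives a polynomial whose values are the integrals of the values. -/
theorem MvPolynomial.exists_eval_eq_integral {σ G : Type*} [TopologicalSpace G] [CompactSpace G]
    [MeasurableSpace G] [BorelSpace G] (μ : Measure G) [IsFiniteMeasure μ]
    (q : MvPolynomial σ C(G, ℝ)) :
    ∃ f : MvPolynomial σ ℝ, ∀ v : σ → ℝ,
      eval v f = ∫ g, (eval (fun i => algebraMap ℝ C(G, ℝ) (v i)) q) g ∂μ := by
  have hint : ∀ a : C(G, ℝ), Integrable (fun g => a g) μ := fun a =>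
    a.continuous.integrable_of_hasCompactSupport (HasCompactSupport.of_compactSpace _)
  induction q using MvPolynomial.induction_on' with
  | monomial s a =>
    refine ⟨monomial s (∫ g, a g ∂μ), fun v => ?_⟩
    simp only [eval_monomial, Finsupp.prod, ← map_pow, ← map_prod]
    simp [integral_mul_const]
  | add p q hp hq =>
    obtain ⟨f₁, h₁⟩ := hp
    obtain ⟨f₂, h₂⟩ := hq
    refine ⟨f₁ + f₂, fun v => ?_⟩
    simp only [map_add, h₁, h₂, ContinuousMap.add_apply]
    exact (integral_add (hint _) (hint _)).symm

/-- Averaging a polynomial over a compact family of linear substitutions gives a polynomial. -/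
theorem MvPolynomial.exists_eval_eq_integral_mulVec_s3 {n : Type*} [Fintype n] {G : Type*}
    [TopologicalSpace G] [CompactSpace G] [MeasurableSpace G] [BorelSpace G] (μ : Measure G)
    [IsFiniteMeasure μ] {A : G → Matrix n n ℝ} (hA : Continuous A) (p : MvPolynomial n ℝ) :
    ∃ f : MvPolynomial n ℝ, ∀ v : n → ℝ, eval v f = ∫ g, eval (A g *ᵥ v) p ∂μ := by
  let a : n → n → C(G, ℝ) := fun i j => ⟨fun g => A g i j, hA.matrix_elem i j⟩
  obtain ⟨f, hf⟩ := exists_eval_eq_integral μ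
    (aeval (fun i => ∑ j, C (a i j) * X j : n → MvPolynomial n C(G, ℝ)) p)
  refine ⟨f, fun v => (hf v).trans (integral_congr_ae (.of_forall fun g => ?_))⟩
  beta_reduce
  clear hf
  induction p using MvPolynomial.induction_on with
  | C r => simp [MvPolynomial.algebraMap_apply]
  | add p q hp hq => simp only [map_add, ContinuousMap.add_apply, hp, hq]
  | mul_X p i hp =>
    simp only [map_mul, ContinuousMap.mul_apply, hp]
    simp [Matrix.mulVec, dotProduct, a]

/-- Polynomial functions are uniformly dense in the continuous functions on a compact set. -/
theorem MvPolynomial.exists_forall_abs_eval_sub_lt {n : Type*} {K : Set (n → ℝ)}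
    (hK : IsCompact K) {φ : (n → ℝ) → ℝ} (hφ : ContinuousOn φ K) {ε : ℝ} (hε : 0 < ε) :
    ∃ p : MvPolynomial n ℝ, ∀ v ∈ K, |eval v p - φ v| < ε := by
  have : CompactSpace K := isCompact_iff_compactSpace.mp hK
  let coord : n → C(K, ℝ) := fun i =>
    ⟨fun v => v.1 i, (continuous_apply i).comp continuous_subtype_val⟩
  have hsep : (aeval coord : MvPolynomial n ℝ →ₐ[ℝ] C(K, ℝ)).range.SeparatesPoints := by
    intro v w hvw
    obtain ⟨i, hi⟩ := Function.ne_iff.mp (Subtype.coe_injective.ne hvw)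
    exact ⟨_, ⟨coord i, ⟨X i, aeval_X _ _⟩, rfl⟩, hi⟩
  obtain ⟨⟨_, p, rfl⟩, hp⟩ :=
    ContinuousMap.exists_mem_subalgebra_near_continuous_of_separatesPoints _ hsep
      (K.domRestrict φ) hφ.domRestrict ε hε
  refine ⟨p, fun v hv => ?_⟩
  have heval : (aeval coord p : C(K, ℝ)) ⟨v, hv⟩ = eval v p := by
    clear hp
    induction p using MvPolynomial.induction_on with
    | C r => simp
    | add p q hp hq => simp [hp, hq]
    | mul_X p i hp => simp [hp, coord]
  exact heval ▸ hp ⟨v, hv⟩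

/-- Invariant polynomials separate the orbits of a compact subgroup `M ⊆ GL_n(ℝ)`:
if `y` does not lie in the orbit `M·x` then some `M`-invariant polynomial takes different
values at `x` and `y`. -/
theorem invariant_poly_separates_orbits {n : ℕ} (M : Subgroup (GL (Fin n) ℝ))
    (hM : IsCompact (M : Set (GL (Fin n) ℝ))) (x y : Fin n → ℝ)
    (hy : y ∉ {v : Fin n → ℝ | ∃ m ∈ M, v = (m : Matrix (Fin n) (Fin n) ℝ).mulVec x}) :
    ∃ f : MvPolynomial (Fin n) ℝ, IsInvariantPoly M f ∧ eval x f ≠ eval y f := by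
  have : CompactSpace M := isCompact_iff_compactSpace.mp hM
  borelize ↥M
  let μ : Measure M := Measure.haar
  let A : M → Matrix (Fin n) (Fin n) ℝ := fun m => ((m⁻¹ : M) : GL (Fin n) ℝ)
  have hA : Continuous A := Units.continuous_val.comp (continuous_subtype_val.comp continuous_inv)
  have hAv : ∀ v, Continuous fun m => A m *ᵥ v := fun v => hA.matrix_mulVec continuous_const
  have hcompact : ∀ v, IsCompact (Set.range fun m => A m *ᵥ v) := fun v =>
    isCompact_range (hAv v)
  have hdisj : Disjoint (Set.range fun m => A m *ᵥ x) (Set.range fun m => A m *ᵥ y) := by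
    rw [Set.disjoint_left]
    rintro _ ⟨m, rfl⟩ ⟨k, hk⟩
    refine hy ⟨k * m⁻¹, (k * m⁻¹).2, ?_⟩
    have := congrArg (((k : GL (Fin n) ℝ) : Matrix (Fin n) (Fin n) ℝ) *ᵥ ·) hk
    simpa [A, Matrix.mulVec_mulVec] using this
  obtain ⟨φ, hφx, hφy, -⟩ := exists_continuous_zero_one_of_isClosed
    (hcompact x).isClosed (hcompact y).isClosed hdisj
  obtain ⟨p, hp⟩ := exists_forall_abs_eval_sub_lt ((hcompact x).union (hcompact y))
    φ.continuous.continuousOn (ε := 1 / 3) (by norm_num)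
  obtain ⟨f, hf⟩ := exists_eval_eq_integral_mulVec_s3 μ hA p
  have hint : ∀ v, Integrable (fun m => eval (A m *ᵥ v) p) μ := fun v =>
    (p.continuous_eval.comp (hAv v)).integrable_of_hasCompactSupport
      (HasCompactSupport.of_compactSpace _)
  refine ⟨f, fun h hh v => ?_, ne_of_lt ?_⟩
  · rw [hf, hf, ← integral_mul_left_eq_self (fun m => eval (A m *ᵥ v) p) (⟨h, hh⟩⁻¹ : M)]
    simp [A, Matrix.mulVec_mulVec, -Matrix.coe_units_inv]
  · have hx : ∀ m, eval (A m *ᵥ x) p ≤ 1 / 3 := fun m => by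
      have h₁ := hp _ (.inl ⟨m, rfl⟩)
      have h₂ : φ (A m *ᵥ x) = 0 := hφx ⟨m, rfl⟩
      beta_reduce at h₁
      rw [h₂, abs_lt] at h₁
      linarith [h₁.2]
    have hy : ∀ m, 2 / 3 ≤ eval (A m *ᵥ y) p := fun m => by
      have h₁ := hp _ (.inr ⟨m, rfl⟩)
      have h₂ : φ (A m *ᵥ y) = 1 := hφy ⟨m, rfl⟩
      beta_reduce at h₁
      rw [h₂, abs_lt] at h₁
      linarith [h₁.1]
    have hμ : 0 < μ.real Set.univ := measureReal_univ_pos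
    rw [hf, hf]
    have h₁ := integral_mono (hint x) (integrable_const _) hx
    have h₂ := integral_mono (integrable_const _) (hint y) hy
    simp only [integral_const, smul_eq_mul] at h₁ h₂
    linarith
end

section
/- Let k be a field of characteristic zero, V a finite-dimensional k-vector space, and N : V → V a nilpotent k-linear endomorphism. Then there exists a unique family (W_l)_{l ∈ ℤ} of linear subspaces of V with W_l ⊆ W_{l+1} for every l, W_l = 0 for all sufficiently small l and W_l = V for all sufficiently large l, such that N(W_l) ⊆ W_{l−2} for every l ∈ ℤ, and such that for every l ≥ 0 the map induced by N^l from W_l / W_{l−1} to W_{−l} / W_{−l−1} is a k-linear isomorphism. -/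
/-- `W` is a monodromy filtration for the nilpotent endomorphism `N`: an increasing,
exhaustive and separated ℤ-indexed filtration by subspaces with `N(W_l) ⊆ W_{l-2}`, such
that for every `l ≥ 0` the map induced by `N^l` from `W_l / W_{l-1}` to
`W_{-l} / W_{-l-1}` is an isomorphism (the latter condition being stated as:
`N^l` maps `W_l` into `W_{-l}`, injectivity and surjectivity of the induced map on the
graded quotients). -/
def IsMonodromyFiltration {k V : Type*} [Field k] [AddCommGroup V] [Module k V]
    (N : V →ₗ[k] V) (W : ℤ → Submodule k V) : Prop :=
  (∀ l : ℤ, W l ≤ W (l + 1)) ∧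
  (∃ a : ℤ, ∀ l ≤ a, W l = ⊥) ∧
  (∃ b : ℤ, ∀ l, b ≤ l → W l = ⊤) ∧
  (∀ l : ℤ, (W l).map N ≤ W (l - 2)) ∧
  (∀ l : ℕ,
    -- `N^l` maps `W_l` into `W_{-l}`, so it induces a map `W_l/W_{l-1} → W_{-l}/W_{-l-1}`
    (∀ v ∈ W (l : ℤ), (N ^ l) v ∈ W (-(l : ℤ))) ∧
    -- the induced map on graded quotients is injective
    (∀ u ∈ W (l : ℤ), (N ^ l) u ∈ W (-(l : ℤ) - 1) → u ∈ W ((l : ℤ) - 1)) ∧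
    -- the induced map on graded quotients is surjective
    (∀ v ∈ W (-(l : ℤ)), ∃ u ∈ W (l : ℤ), v - (N ^ l) u ∈ W (-(l : ℤ) - 1)))

namespace IsMonodromyFiltration

variable {k V : Type*} [Field k] [AddCommGroup V] [Module k V] {N : V →ₗ[k] V}
  {W W' : ℤ → Submodule k V}

theorem monotone (h : IsMonodromyFiltration N W) : Monotone W :=
  monotone_int_of_le_succ h.1

theorem pow_apply_mem (h : IsMonodromyFiltration N W) (j : ℕ) {l : ℤ} {v : V} (hv : v ∈ W l) :
    (N ^ j) v ∈ W (l - 2 * j) := by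
  induction j with
  | zero => simpa using hv
  | succ j ih =>
    have := h.2.2.2.1 _ (Submodule.mem_map_of_mem ih)
    rw [pow_succ', Module.End.mul_apply]
    convert this using 2
    push_cast
    ring

theorem apply_mem (h : IsMonodromyFiltration N W) {l : ℤ} {v : V} (hv : v ∈ W (l + 2)) :
    N v ∈ W l := by
  simpa using h.pow_apply_mem 1 hv

theorem ker_pow_le (h : IsMonodromyFiltration N W) (l : ℕ) :
    LinearMap.ker (N ^ l) ≤ W (l - 1) := by
  intro u hu
  rw [LinearMap.mem_ker] at hu
  obtain ⟨b, hb⟩ := h.2.2.1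
  have descend : ∀ n : ℕ, u ∈ W ((l : ℤ) - 1 + n) → u ∈ W ((l : ℤ) - 1) := by
    intro n
    induction n with
    | zero => simp
    | succ n ih =>
      intro hn
      refine ih ?_
      have hinj := (h.2.2.2.2 (l + n)).2.1 u (by convert hn using 2; push_cast; ring) (by
        rw [add_comm, pow_add, Module.End.mul_apply, hu, map_zero]
        exact zero_mem _)
      convert hinj using 2
      push_cast
      ring
  refine descend (b - (l - 1)).toNat ?_
  rw [hb _ (by lia)]
  trivial

theorem exists_pow_apply_eq (h : IsMonodromyFiltration N W) (l : ℕ) {v : V}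
    (hv : v ∈ W (-(l : ℤ))) : ∃ u ∈ W (l : ℤ), (N ^ l) u = v := by
  obtain ⟨a, ha⟩ := h.2.1
  have ascend : ∀ n l : ℕ, W (-((l + n : ℕ) : ℤ)) = ⊥ → ∀ v ∈ W (-(l : ℤ)),
      ∃ u ∈ W (l : ℤ), (N ^ l) u = v := by
    intro n
    induction n with
    | zero =>
      intro l hl v hv
      rw [add_zero] at hl
      rw [hl, Submodule.mem_bot] at hv
      exact ⟨0, zero_mem _, by simp [hv]⟩
    | succ n ih =>
      intro l hl v hv
      obtain ⟨u, hu, huv⟩ := (h.2.2.2.2 l).2.2 v hv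
      obtain ⟨w, hw, hwv⟩ := ih (l + 1) (by rw [← hl]; congr 3; ring) (v - (N ^ l) u) (by
        convert huv using 2; push_cast; ring)
      refine ⟨u + N w, add_mem hu (h.apply_mem (h.monotone (by push_cast; lia) hw)), ?_⟩
      rw [map_add, ← Module.End.mul_apply, ← pow_succ, hwv]
      abel
  exact ascend (-a).toNat l (ha _ (by lia)) v hv

theorem le (h : IsMonodromyFiltration N W) (h' : IsMonodromyFiltration N W') : W ≤ W' := by
  obtain ⟨b, hb⟩ := h'.2.2.1
  have nonneg : ∀ n l : ℕ, b ≤ l + n → W (l : ℤ) ≤ W' (l : ℤ) := by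
    intro n
    induction n with
    | zero =>
      intro l hl
      rw [hb l (by lia)]
      exact le_top
    | succ n ih =>
      intro l hl u hu
      have hN : (N ^ (l + 1)) u ∈ W (-((l + 2 : ℕ) : ℤ)) := by
        convert h.pow_apply_mem (l + 1) hu using 2
        push_cast
        ring
      obtain ⟨w, hw, hwu⟩ := h.exists_pow_apply_eq (l + 2) hN
      have hker : u - N w ∈ W' (((l + 1 : ℕ) : ℤ) - 1) := by
        refine h'.ker_pow_le (l + 1) ?_
        rw [LinearMap.mem_ker, map_sub, ← Module.End.mul_apply (N ^ (l + 1)), ← pow_succ, hwu,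
          sub_self]
      have hNw : N w ∈ W' (l : ℤ) :=
        h'.apply_mem (by exact_mod_cast ih (l + 2) (by push_cast; lia) hw)
      have := add_mem (by simpa using hker) hNw
      simpa using this
  intro l
  obtain ⟨m, rfl | rfl⟩ := l.eq_nat_or_neg
  · exact nonneg (b - m).toNat m (by lia)
  · intro v hv
    obtain ⟨u, hu, rfl⟩ := h.exists_pow_apply_eq m hv
    exact (h'.2.2.2.2 m).1 u (nonneg (b - m).toNat m (by lia) hu)

end IsMonodromyFiltration

namespace LinearMap

variable {k V : Type*} [Field k] [AddCommGroup V] [Module k V]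

/-- The filtration `W_l = ∑_j N^j (ker N^(l + 2j + 1))`, the sum being over those `j ≥ 0` for
which the exponent `l + 2j + 1` is nonnegative. -/
def monodromyFiltration (N : V →ₗ[k] V) (l : ℤ) : Submodule k V :=
  ⨆ (j : ℕ) (m : ℕ) (_ : (m : ℤ) = l + 2 * j + 1), (ker (N ^ m)).map (N ^ j)

theorem pow_apply_mem_monodromyFiltration {N : V →ₗ[k] V} {l : ℤ} {x : V} (j m : ℕ)
    (hm : (m : ℤ) = l + 2 * j + 1) (hx : (N ^ m) x = 0) :
    (N ^ j) x ∈ monodromyFiltration N l :=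
  Submodule.mem_iSup_of_mem j <| Submodule.mem_iSup_of_mem m <| Submodule.mem_iSup_of_mem hm <|
    Submodule.mem_map_of_mem (mem_ker.2 hx)

theorem monodromyFiltration_le {N : V →ₗ[k] V} {l : ℤ} {P : Submodule k V}
    (h : ∀ j m : ℕ, (m : ℤ) = l + 2 * j + 1 → ∀ x, (N ^ m) x = 0 → (N ^ j) x ∈ P) :
    monodromyFiltration N l ≤ P := by
  refine iSup_le fun j => iSup_le fun m => iSup_le fun hm => ?_
  rintro _ ⟨x, hx, rfl⟩
  exact h j m hm x hx

theorem monodromyFiltration_le_succ (N : V →ₗ[k] V) (l : ℤ) :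
    monodromyFiltration N l ≤ monodromyFiltration N (l + 1) :=
  monodromyFiltration_le fun j m hm x hx =>
    pow_apply_mem_monodromyFiltration j (m + 1) (by push_cast; lia) (by
      rw [pow_succ', Module.End.mul_apply, hx, map_zero])

theorem map_monodromyFiltration_le (N : V →ₗ[k] V) (l : ℤ) :
    (monodromyFiltration N l).map N ≤ monodromyFiltration N (l - 2) := by
  refine Submodule.map_le_iff_le_comap.2 (monodromyFiltration_le fun j m hm x hx => ?_)
  rw [Submodule.mem_comap, ← Module.End.mul_apply, ← pow_succ']
  exact pow_apply_mem_monodromyFiltration (j + 1) m (by push_cast; lia) hx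

theorem monodromyFiltration_neg (N : V →ₗ[k] V) (l : ℕ) :
    monodromyFiltration N (-(l : ℤ)) = (monodromyFiltration N l).map (N ^ l) := by
  refine le_antisymm (monodromyFiltration_le fun j m hm x hx => ?_)
    (Submodule.map_le_iff_le_comap.2 (monodromyFiltration_le fun j m hm x hx => ?_))
  · obtain hlj | hjl := le_or_gt l j
    · obtain ⟨i, rfl⟩ := Nat.exists_eq_add_of_le hlj
      rw [pow_add, Module.End.mul_apply]
      refine Submodule.mem_map_of_mem (pow_apply_mem_monodromyFiltration i m ?_ hx)
      push_cast at hm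
      lia
    · rw [Module.End.pow_map_zero_of_le (by lia : m ≤ j) hx]
      exact zero_mem _
  · rw [Submodule.mem_comap, ← Module.End.mul_apply, ← pow_add]
    exact pow_apply_mem_monodromyFiltration (l + j) m (by push_cast; lia) hx

theorem isMonodromyFiltration_monodromyFiltration {N : V →ₗ[k] V} (hN : IsNilpotent N) :
    IsMonodromyFiltration N (monodromyFiltration N) := by
  obtain ⟨d, hd⟩ := hN
  refine ⟨monodromyFiltration_le_succ N, ⟨-2 * d - 1, fun l hl => ?_⟩, ⟨d, fun l hl => ?_⟩,
    map_monodromyFiltration_le N, fun l => ⟨fun v hv => ?_, fun u _ hNu => ?_, fun v hv => ?_⟩⟩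
  · refine eq_bot_iff.2 (monodromyFiltration_le fun j m hm x _ => ?_)
    simp [pow_eq_zero_of_le (by lia : d ≤ j) hd]
  · refine eq_top_iff.2 fun x _ => ?_
    refine pow_apply_mem_monodromyFiltration 0 (l + 1).toNat (by lia) ?_
    simp [pow_eq_zero_of_le (by lia : d ≤ (l + 1).toNat) hd]
  · rw [monodromyFiltration_neg]
    exact Submodule.mem_map_of_mem hv
  · rw [show -(l : ℤ) - 1 = -((l + 1 : ℕ) : ℤ) by push_cast; ring,
      monodromyFiltration_neg] at hNu
    obtain ⟨w, hw, hwu⟩ := hNu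
    have hker : u - N w ∈ monodromyFiltration N ((l : ℤ) - 1) := by
      refine pow_apply_mem_monodromyFiltration (x := u - N w) 0 l (by simp) ?_
      rw [map_sub, ← Module.End.mul_apply (N ^ l), ← pow_succ, hwu, sub_self]
    have hNw : N w ∈ monodromyFiltration N ((l : ℤ) - 1) := by
      convert map_monodromyFiltration_le N _ (Submodule.mem_map_of_mem hw) using 2
      push_cast
      ring
    simpa using add_mem hker hNw
  · rw [monodromyFiltration_neg] at hv
    obtain ⟨u, hu, rfl⟩ := hv
    exact ⟨u, hu, by simp⟩

end LinearMap

/-- Existence and uniqueness of the monodromy filtration of a nilpotent endomorphism of a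
finite-dimensional vector space over a field of characteristic zero. -/
theorem existsUnique_monodromyFiltration {k V : Type*} [Field k] [CharZero k]
    [AddCommGroup V] [Module k V] [FiniteDimensional k V]
    (N : V →ₗ[k] V) (hN : IsNilpotent N) :
    ∃! W : ℤ → Submodule k V, IsMonodromyFiltration N W := by
  exact ⟨LinearMap.monodromyFiltration N, LinearMap.isMonodromyFiltration_monodromyFiltration hN,
    fun W hW => le_antisymm (hW.le (LinearMap.isMonodromyFiltration_monodromyFiltration hN))
      ((LinearMap.isMonodromyFiltration_monodromyFiltration hN).le hW)⟩
end
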